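/- arXiv:1307.2805 — 2 statements merged into one kernel-verified Lean document; each statement's English description precedes it below -/
import Mathlib

section
/- Separation of points in configurations minimizing the smeared jellium energy: There exist η_0 > 0, r_0 > 0, C > 0 and R_0 > 0 depending only on d and ρ with the following property. Let 0 < η < η_0, R ≥ R_0, let K be a closed hyperrectangle in ℝ^d with all sidelengths in [2R, 3R], let Λ ⊂ K be finite, N : Λ → {1,2,3,…}, and let h ∈ C¹(int K) with ∫_K |∇h|² < ∞ satisfy, for every φ ∈ C_c^∞(int K), ∫ ∇h·∇φ = c_d ( Σ_{p∈Λ} N_p ∫ ρ_η(x−p) φ(x) dx − ∫ φ ). Let Λ_R = { p ∈ Λ : dist(p, ∂K) ≥ 1 }. If either some p ∈ Λ_R has N_p ≥ 2, or two distinct points p, p' ∈ Λ_R satisfy |p − p'| < r_0, then there exist a finite set Λ̃ ⊂ K, a map Ñ : Λ̃ → {1,2,3,…} and h̃ ∈ C¹(int K) satisfying the analogous weak equation with (Λ̃, Ñ) in place of (Λ, N), such that ∫_K |∇h̃|² ≤ ∫_K |∇h|² − C. -/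
open MeasureTheory Metric Real Filter
open scoped Topology ENNReal BigOperators RealInnerProductSpace

noncomputable section

/-- Euclidean space `ℝ^d`. -/
abbrev Euc (d : ℕ) := EuclideanSpace ℝ (Fin d)

/-- The constant `c_d`: `2π` for `d = 2` and `(d−2)|S^{d−1}|` for `d ≥ 3`
(using `|S^{d-1}| = d · |B(0,1)|`). -/
def cConst (d : ℕ) : ℝ :=
  if d = 2 then 2 * π
  else ((d : ℝ) - 2) * d * (volume (ball (0 : Euc d) 1)).toReal

/-- The smeared Dirac mass `δ_p^{(η)}`: density `ρ_η(x - p)` with `ρ_η(x) = η^{-d} ρ(x/η)`. -/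
def smear (d : ℕ) (ρ : Euc d → ℝ) (η : ℝ) (p : Euc d) (x : Euc d) : ℝ :=
  (η ^ d)⁻¹ * ρ (η⁻¹ • (x - p))

/-- `h` solves `−Δh = c_d (Σ_{p∈Λ} N_p δ_p^{(η)} − 1)` weakly in the interior of `K`. -/
def WeakJellium (d : ℕ) (ρ : Euc d → ℝ) (η : ℝ) (K : Set (Euc d))
    (Λ : Finset (Euc d)) (N : Euc d → ℕ) (h : Euc d → ℝ) : Prop :=
  ∀ φ : Euc d → ℝ, ContDiff ℝ (⊤ : ℕ∞) φ → HasCompactSupport φ → tsupport φ ⊆ interior K →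
    ∫ x, ⟪gradient h x, gradient φ x⟫ =
      cConst d * ((∑ p ∈ Λ, (N p : ℝ) * ∫ x, smear d ρ η p x * φ x) - ∫ x, φ x)

/-- The mass (up to the constant `|S^{d-1}|`) in the ball of radius `|r|` of the radial density
with profile `g`. -/
def radMass (d : ℕ) (g : ℝ → ℝ) (r : ℝ) : ℝ := ∫ τ in (0 : ℝ)..|r|, τ ^ (d - 1) * g τ

/-- The radial derivative of the potential generated by the radial density with profile `g`. -/
def radKer (d : ℕ) (g : ℝ → ℝ) (r : ℝ) : ℝ := radMass d g r / |r| ^ (d - 1)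

/-- The radial vector field with radial component `k ‖x‖`. -/
def radField {d : ℕ} (k : ℝ → ℝ) (x : Euc d) : Euc d := (k ‖x‖ / ‖x‖) • x

/-- The radial function whose radial derivative is `k`. -/
def radPot {d : ℕ} (k : ℝ → ℝ) (x : Euc d) : ℝ := ∫ r in (0 : ℝ)..‖x‖, k r

lemma integral_Ioi_dilation_eq_radMass {d : ℕ} (hd : 1 ≤ d) (g : ℝ → ℝ) {R : ℝ} (hR : 0 < R) :
    ∫ l in Set.Ioi (1 : ℝ), (l ^ (d + 1))⁻¹ * g (R / l) = (R ^ d)⁻¹ * radMass d g R := by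
  have himg : (fun l : ℝ => R / l) '' Set.Ioi 1 = Set.Ioo 0 R := by
    ext r
    constructor
    · rintro ⟨l, hl, rfl⟩
      have hl' : (1 : ℝ) < l := hl
      refine ⟨by positivity, ?_⟩
      exact (div_lt_self hR hl')
    · rintro ⟨h0, h1⟩
      exact ⟨R / r, (one_lt_div h0).2 h1, by field_simp⟩
  have hinj : Set.InjOn (fun l : ℝ => R / l) (Set.Ioi 1) := by
    intro l hl l' hl' h
    have h1 : (1 : ℝ) < l := hl
    have h2 : (1 : ℝ) < l' := hl'
    have : R / l = R / l' := h
    rw [div_eq_div_iff (by positivity) (by positivity)] at this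
    exact (mul_left_cancel₀ hR.ne' this).symm
  have hder : ∀ l ∈ Set.Ioi (1 : ℝ),
      HasDerivWithinAt (fun l : ℝ => R / l) (-R / l ^ 2) (Set.Ioi 1) l := by
    intro l hl
    have h1 : (1 : ℝ) < l := hl
    have hl0 : l ≠ 0 := by positivity
    exact (((hasDerivAt_const l R).fun_div (hasDerivAt_id' l) hl0).congr_deriv
      (by simp)).hasDerivWithinAt
  have key := integral_image_eq_integral_abs_deriv_smul measurableSet_Ioi hder hinj
    (fun r => r ^ (d - 1) * g r)
  rw [himg] at key
  rw [radMass, abs_of_pos hR, intervalIntegral.integral_of_le hR.le, integral_Ioc_eq_integral_Ioo,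
    key, ← integral_const_mul]
  refine setIntegral_congr_fun measurableSet_Ioi fun l hl => ?_
  have h1 : (1 : ℝ) < l := hl
  have hl0 : 0 < l := by positivity
  obtain ⟨n, rfl⟩ : ∃ n, d = n + 1 := ⟨d - 1, by omega⟩
  simp only [smul_eq_mul, neg_div, abs_neg, abs_of_pos (show 0 < R / l ^ 2 by positivity),
    Nat.add_sub_cancel, div_pow]
  field_simp
  ring

lemma integral_Ioi_fderiv_smul {d : ℕ} {φ : Euc d → ℝ} (hφ : ContDiff ℝ 1 φ)
    (hc : HasCompactSupport φ) :
    ∃ C : ℝ, ∀ y : Euc d, y ≠ 0 →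
      IntegrableOn (fun l : ℝ => fderiv ℝ φ (l • y) y) (Set.Ioi 1) ∧
      ∫ l in Set.Ioi (1 : ℝ), ‖fderiv ℝ φ (l • y) y‖ ≤ C ∧
      ∫ l in Set.Ioi (1 : ℝ), fderiv ℝ φ (l • y) y = - φ y := by
  have hcf : Continuous (fderiv ℝ φ) := hφ.continuous_fderiv one_ne_zero
  obtain ⟨M, hM⟩ := (hc.fderiv (𝕜 := ℝ)).exists_bound_of_continuous hcf
  obtain ⟨R, hR0, hR⟩ : ∃ R > 0, ∀ x, R < ‖x‖ → φ x = 0 ∧ fderiv ℝ φ x = 0 := by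
    obtain ⟨R, hR⟩ := hc.isCompact.isBounded.subset_closedBall (0 : Euc d)
    refine ⟨max R 1, by positivity, fun x hx => ?_⟩
    have hx' : x ∉ tsupport φ := fun h => by
      have := hR h
      rw [mem_closedBall_zero_iff] at this
      exact absurd hx (not_lt.2 (this.trans (le_max_left _ _)))
    refine ⟨image_eq_zero_of_notMem_tsupport hx', ?_⟩
    have : x ∉ tsupport (fderiv ℝ φ) := fun h => hx' (tsupport_fderiv_subset ℝ h)
    exact image_eq_zero_of_notMem_tsupport this
  have hM0 : 0 ≤ M := (norm_nonneg _).trans (hM 0)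
  refine ⟨M * R, fun y hy => ?_⟩
  have hy0 : 0 < ‖y‖ := norm_pos_iff.2 hy
  have hcont : Continuous fun l : ℝ => fderiv ℝ φ (l • y) y := by fun_prop
  have hbd : ∀ l ∈ Set.Ioi (1 : ℝ), ‖fderiv ℝ φ (l • y) y‖ ≤
      (Set.Ioc 0 (R / ‖y‖)).indicator (fun _ => M * ‖y‖) l := by
    intro l hl
    have hl1 : (1 : ℝ) < l := hl
    by_cases h : l ≤ R / ‖y‖
    · rw [Set.indicator_of_mem (show l ∈ Set.Ioc 0 (R / ‖y‖) from ⟨by linarith, h⟩)]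
      exact ((fderiv ℝ φ (l • y)).le_opNorm y).trans (by gcongr; exact hM _)
    · rw [Set.indicator_of_notMem (fun h' => h h'.2)]
      have : R < ‖l • y‖ := by
        rw [norm_smul, Real.norm_of_nonneg (by linarith)]
        rw [not_le, div_lt_iff₀ hy0] at h
        exact h
      simp [(hR _ this).2]
  have hind : Integrable ((Set.Ioc 0 (R / ‖y‖)).indicator (fun _ => M * ‖y‖)) :=
    (integrable_indicator_iff measurableSet_Ioc).2 (integrableOn_const (by simp))
  have hint : IntegrableOn (fun l : ℝ => fderiv ℝ φ (l • y) y) (Set.Ioi 1) :=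
    Integrable.mono' hind.integrableOn hcont.aestronglyMeasurable
      ((ae_restrict_iff' measurableSet_Ioi).2 (.of_forall hbd))
  refine ⟨hint, ?_, ?_⟩
  · calc ∫ l in Set.Ioi (1 : ℝ), ‖fderiv ℝ φ (l • y) y‖
        ≤ ∫ l in Set.Ioi (1 : ℝ), (Set.Ioc 0 (R / ‖y‖)).indicator (fun _ => M * ‖y‖) l :=
          setIntegral_mono_on hint.norm hind.integrableOn measurableSet_Ioi hbd
      _ ≤ ∫ l, (Set.Ioc 0 (R / ‖y‖)).indicator (fun _ => M * ‖y‖) l :=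
          setIntegral_le_integral hind (.of_forall fun l =>
            Set.indicator_nonneg (fun _ _ => by positivity) _)
      _ = M * R := by
          rw [integral_indicator measurableSet_Ioc, setIntegral_const]
          simp only [measureReal_def, Real.volume_Ioc, sub_zero, smul_eq_mul]
          rw [ENNReal.toReal_ofReal (by positivity)]
          field_simp
  · have hd : ∀ l ∈ Set.Ici (1 : ℝ), HasDerivAt (fun l : ℝ => φ (l • y)) (fderiv ℝ φ (l • y) y) l := by
      intro l _
      have h1 : HasDerivAt (fun l : ℝ => l • y) y l := by
        simpa using (hasDerivAt_id l).smul_const y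
      exact ((hφ.differentiable one_ne_zero) (l • y)).hasFDerivAt.comp_hasDerivAt l h1
    have ht : Tendsto (fun l : ℝ => φ (l • y)) atTop (𝓝 0) := by
      refine tendsto_const_nhds.congr' ?_
      filter_upwards [eventually_gt_atTop (R / ‖y‖), eventually_gt_atTop 0] with l hl hl0
      rw [div_lt_iff₀ hy0] at hl
      refine ((hR _ ?_).1).symm
      rwa [norm_smul, Real.norm_of_nonneg hl0.le]
    have := integral_Ioi_of_hasDerivAt_of_tendsto' hd hint ht
    simpa using this

/-- The radial field generated by a radial density solves the weak Poisson equation. -/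
theorem integral_inner_radField {d : ℕ} (hd : 1 ≤ d) {g : ℝ → ℝ} (hg : Measurable g)
    (hgi : Integrable fun x : Euc d => g ‖x‖) {φ : Euc d → ℝ} (hφ : ContDiff ℝ 1 φ)
    (hc : HasCompactSupport φ) :
    ∫ x, ⟪radField (radKer d g) x, gradient φ x⟫ = - ∫ x : Euc d, g ‖x‖ * φ x := by
  have : Nonempty (Fin d) := ⟨⟨0, hd⟩⟩
  obtain ⟨C, hC⟩ := integral_Ioi_fderiv_smul hφ hc
  have hcf : Continuous (fderiv ℝ φ) := hφ.continuous_fderiv one_ne_zero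
  have hne : ∀ᵐ y : Euc d, y ≠ 0 := by
    simp [ae_iff, measure_singleton]
  set ν : Measure ℝ := volume.restrict (Set.Ioi 1) with hν
  set H : Euc d × ℝ → ℝ := fun z => g ‖z.1‖ * fderiv ℝ φ (z.2 • z.1) z.1 with hH
  have hHm : Measurable H := by
    refine (hg.comp measurable_fst.norm).mul (Continuous.measurable ?_)
    fun_prop
  have hHint : Integrable H (volume.prod ν) := by
    rw [integrable_prod_iff hHm.aestronglyMeasurable]
    constructor
    · filter_upwards [hne] with y hy
      exact Integrable.const_mul (hC y hy).1 (g ‖y‖)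
    · refine Integrable.mono' (hgi.norm.mul_const C) ?_ ?_
      · exact (hHm.norm.stronglyMeasurable.integral_prod_right').aestronglyMeasurable
      · filter_upwards [hne] with y hy
        simp only [hH, norm_mul]
        rw [integral_const_mul, Real.norm_of_nonneg (mul_nonneg (norm_nonneg _)
          (integral_nonneg fun _ => norm_nonneg _))]
        gcongr
        exact (hC y hy).2.1
  set H2 : ℝ × Euc d → ℝ :=
    fun z => ((z.1 ^ (d + 1))⁻¹ * g (‖z.2‖ / z.1)) * fderiv ℝ φ z.2 z.2 with hH2
  have hH2m : Measurable H2 := by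
    refine (((measurable_fst.pow_const _).inv).mul
      (hg.comp (measurable_snd.norm.div measurable_fst))).mul (Continuous.measurable ?_)
    fun_prop
  have hrel : ∀ l : ℝ, 1 < l → ∀ y : Euc d, H (y, l) = l ^ d * H2 (l, l • y) := by
    intro l hl y
    have hl0 : 0 < l := by linarith
    simp only [hH, hH2, norm_smul, Real.norm_of_nonneg hl0.le, map_smul, smul_eq_mul]
    rw [mul_div_cancel_left₀ _ hl0.ne']
    field_simp
    ring
  have hslice : ∀ f : ℝ → ℝ, (∀ a b, 0 ≤ a → f (a * b) = a * f b) → ∀ l : ℝ, 1 < l →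
      ∫ y, f (H (y, l)) = ∫ x, f (H2 (l, x)) := by
    intro f hf l hl
    have hl0 : 0 < l := by linarith
    have h1 : ∀ y, f (H (y, l)) = l ^ d * f (H2 (l, l • y)) := fun y => by
      rw [hrel l hl, hf _ _ (by positivity)]
    simp_rw [h1]
    rw [integral_const_mul, Measure.integral_comp_smul volume (fun x => f (H2 (l, x))) l,
      finrank_euclideanSpace_fin, abs_of_pos (by positivity), smul_eq_mul]
    field_simp
  have hH2int : Integrable H2 (ν.prod volume) := by
    rw [integrable_prod_iff hH2m.aestronglyMeasurable]
    constructor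
    · have h := hHint.prod_left_ae
      have hpos : ∀ᵐ l ∂ν, 1 < l := ae_restrict_mem measurableSet_Ioi
      filter_upwards [h, hpos] with l h1 hl
      have hl0 : 0 < l := by linarith
      have h2 : Integrable fun y => H2 (l, l • y) := by
        refine (h1.const_mul ((l ^ d)⁻¹)).congr (.of_forall fun y => ?_)
        simp only [hrel l hl y]
        field_simp
      exact (integrable_comp_smul_iff volume (fun x => H2 (l, x)) hl0.ne').1 h2
    · refine hHint.integral_norm_prod_right.congr ?_
      have hpos : ∀ᵐ l ∂ν, 1 < l := ae_restrict_mem measurableSet_Ioi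
      filter_upwards [hpos] with l hl
      exact hslice norm (fun a b ha => by rw [norm_mul, Real.norm_of_nonneg ha]) l hl
  have e1 : ∫ y, ∫ l, H (y, l) ∂ν = - ∫ x : Euc d, g ‖x‖ * φ x := by
    rw [← integral_neg]
    refine integral_congr_ae ?_
    filter_upwards [hne] with y hy
    simp only [hH]
    rw [integral_const_mul, (hC y hy).2.2]
    ring
  have e2 : ∫ x, ∫ l, H2 (l, x) ∂ν = ∫ x, ⟪radField (radKer d g) x, gradient φ x⟫ := by
    refine integral_congr_ae ?_
    filter_upwards [hne] with x hx
    have hx0 : 0 < ‖x‖ := norm_pos_iff.2 hx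
    simp only [hH2]
    rw [integral_mul_const, hν, integral_Ioi_dilation_eq_radMass hd g hx0, real_inner_comm,
      inner_gradient_left]
    simp only [radField, radKer, map_smul, smul_eq_mul, abs_norm]
    obtain ⟨n, rfl⟩ : ∃ n, d = n + 1 := ⟨d - 1, by omega⟩
    simp only [Nat.add_sub_cancel]
    field_simp
    ring
  rw [← e1, ← e2, integral_integral_swap (f := fun y l => H (y, l)) hHint,
    integral_integral_swap (f := fun x l => H2 (l, x)) hH2int.swap]
  refine integral_congr_ae ?_
  have hpos : ∀ᵐ l ∂ν, 1 < l := ae_restrict_mem measurableSet_Ioi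
  filter_upwards [hpos] with l hl
  exact (hslice id (fun a b _ => rfl) l hl).symm

lemma contDiff_one_of_hasGradientAt {d : ℕ} {f : Euc d → ℝ} {G : Euc d → Euc d}
    (hf : ∀ x, HasGradientAt f (G x) x) (hG : Continuous G) : ContDiff ℝ 1 f := by
  rw [contDiff_one_iff_fderiv]
  refine ⟨fun x => (hf x).differentiableAt, ?_⟩
  have : fderiv ℝ f = fun x => InnerProductSpace.toDual ℝ (Euc d) (G x) :=
    funext fun x => (hf x).hasFDerivAt.fderiv
  rw [this]
  exact (InnerProductSpace.toDual ℝ (Euc d)).continuous.comp hG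

lemma norm_radField_le {d : ℕ} (k : ℝ → ℝ) (x : Euc d) : ‖radField k x‖ ≤ |k ‖x‖| := by
  rw [radField, norm_smul, norm_div, norm_norm, Real.norm_eq_abs]
  rcases eq_or_ne ‖x‖ 0 with h | h
  · simp [h]
  · rw [div_mul_cancel₀ _ h]

lemma continuous_radField {d : ℕ} {k : ℝ → ℝ} (hk : Continuous k) (hk0 : k 0 = 0) :
    Continuous (radField k : Euc d → Euc d) := by
  rw [continuous_iff_continuousAt]
  intro x
  rcases eq_or_ne x 0 with rfl | hx
  · have h1 : Tendsto (fun x : Euc d => |k ‖x‖|) (𝓝 0) (𝓝 0) := by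
      have : Continuous fun x : Euc d => |k ‖x‖| := by fun_prop
      simpa [hk0] using this.tendsto 0
    have h2 : radField k (0 : Euc d) = 0 := by simp [radField]
    rw [ContinuousAt, h2]
    exact squeeze_zero_norm (norm_radField_le k) h1
  · have h : ‖x‖ ≠ 0 := norm_ne_zero_iff.2 hx
    unfold radField
    fun_prop (disch := assumption)

lemma hasGradientAt_radPot {d : ℕ} {k : ℝ → ℝ} (hk : Continuous k) (hk0 : k 0 = 0) (x : Euc d) :
    HasGradientAt (radPot k) (radField k x) x := by
  have hder : ∀ r, HasDerivAt (fun r => ∫ s in (0 : ℝ)..r, k s) (k r) r := fun r =>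
    (hk.integral_hasStrictDerivAt 0 r).hasDerivAt
  rw [hasGradientAt_iff_hasFDerivAt]
  rcases eq_or_ne x 0 with rfl | hx
  · have h2 : radField k (0 : Euc d) = 0 := by simp [radField]
    rw [h2, map_zero, hasFDerivAt_iff_isLittleO_nhds_zero]
    have h0 := (hasDerivAt_iff_isLittleO_nhds_zero.1 (hder 0))
    simp only [hk0, zero_add, intervalIntegral.integral_same, sub_zero, smul_zero] at h0
    have ht : Tendsto (fun x : Euc d => ‖x‖) (𝓝 0) (𝓝 0) := by
      simpa using (continuous_norm (E := Euc d)).tendsto 0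
    have := h0.comp_tendsto ht
    simp only [Function.comp_def] at this
    simpa [radPot] using this.of_norm_right
  · have hn : HasFDerivAt (fun x : Euc d => ‖x‖)
        (InnerProductSpace.toDual ℝ (Euc d) (‖x‖⁻¹ • x)) x := by
      have h1 := (hasStrictFDerivAt_norm_sq x).hasFDerivAt.sqrt (by simpa using hx)
      have h2 : (fun y : Euc d => √(‖y‖ ^ 2)) = fun y => ‖y‖ := by
        funext y; exact Real.sqrt_sq (norm_nonneg _)
      rw [h2, Real.sqrt_sq (norm_nonneg _)] at h1
      refine h1.congr_fderiv ?_
      ext v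
      simp
      ring
    refine ((hder ‖x‖).comp_hasFDerivAt x hn).congr_fderiv ?_
    ext v
    simp [radField, div_eq_mul_inv, mul_assoc]

lemma contDiff_radPot {d : ℕ} {k : ℝ → ℝ} (hk : Continuous k) (hk0 : k 0 = 0) :
    ContDiff ℝ 1 (radPot k : Euc d → ℝ) :=
  contDiff_one_of_hasGradientAt (hasGradientAt_radPot hk hk0) (continuous_radField hk hk0)

/-- The surface area of the unit sphere. -/
def sphArea (d : ℕ) : ℝ := d * (volume (ball (0 : Euc d) 1)).toReal

lemma sphArea_pos {d : ℕ} (hd : 1 ≤ d) : 0 < sphArea d := by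
  have h1 : 0 < (volume (ball (0 : Euc d) 1)).toReal :=
    ENNReal.toReal_pos (measure_ball_pos _ _ one_pos).ne' measure_ball_lt_top.ne
  have h2 : (0 : ℝ) < d := by exact_mod_cast hd
  exact mul_pos h2 h1

lemma cConst_pos {d : ℕ} (hd : 2 ≤ d) : 0 < cConst d := by
  unfold cConst
  split_ifs with h
  · positivity
  · have h3 : (3 : ℝ) ≤ d := by exact_mod_cast (show 3 ≤ d by omega)
    have := sphArea_pos (show 1 ≤ d by omega)
    rw [sphArea] at this
    rw [mul_assoc]
    exact mul_pos (by linarith) this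

section profile

variable {d : ℕ} {g : ℝ → ℝ}

lemma radMass_integrable (hd : 1 ≤ d) (hgi : Integrable fun x : Euc d => g ‖x‖) :
    IntegrableOn (fun τ : ℝ => τ ^ (d - 1) * g τ) (Set.Ioi 0) := by
  have : Nonempty (Fin d) := ⟨⟨0, hd⟩⟩
  have := (integrable_fun_norm_addHaar (E := Euc d) volume (f := g)).1 hgi
  simpa using this

lemma sphArea_mul_radMass (hd : 1 ≤ d) {r : ℝ} (hr : 0 ≤ r) :
    sphArea d * radMass d g r = ∫ x in closedBall (0 : Euc d) r, g ‖x‖ := by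
  have : Nonempty (Fin d) := ⟨⟨0, hd⟩⟩
  have h := integral_fun_norm_addHaar (E := Euc d) volume ((Set.Iic r).indicator g)
  have h1 : ∀ x : Euc d, (Set.Iic r).indicator g ‖x‖ =
      (closedBall (0 : Euc d) r).indicator (fun x => g ‖x‖) x := by
    intro x
    by_cases hx : ‖x‖ ≤ r <;> simp [Set.indicator, hx]
  simp_rw [h1] at h
  rw [integral_indicator measurableSet_closedBall] at h
  rw [h, radMass, abs_of_nonneg hr, intervalIntegral.integral_of_le hr]
  have h2 : ∀ y : ℝ, y ^ (Module.finrank ℝ (Euc d) - 1) • (Set.Iic r).indicator g y =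
      (Set.Iic r).indicator (fun y => y ^ (d - 1) * g y) y := by
    intro y
    by_cases hx : y ≤ r <;> simp [Set.indicator, hx]
  simp_rw [h2]
  rw [setIntegral_indicator measurableSet_Iic, Set.Ioi_inter_Iic]
  simp [sphArea, measureReal_def, mul_assoc]

lemma continuous_radMass (hd : 1 ≤ d) (hgi : Integrable fun x : Euc d => g ‖x‖) :
    Continuous (radMass d g) := by
  have h := (integrable_indicator_iff measurableSet_Ioi).2 (radMass_integrable hd hgi)
  have h2 : radMass d g = fun r => ∫ τ in (0 : ℝ)..|r|,
      (Set.Ioi 0).indicator (fun τ : ℝ => τ ^ (d - 1) * g τ) τ := by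
    funext r
    rw [radMass]
    refine intervalIntegral.integral_congr_ae (.of_forall fun τ hτ => ?_)
    rw [Set.uIoc_of_le (abs_nonneg r)] at hτ
    rw [Set.indicator_of_mem (show τ ∈ Set.Ioi 0 from hτ.1)]
  rw [h2]
  exact (intervalIntegral.continuous_primitive (fun a b => h.intervalIntegrable) 0).comp
    continuous_abs

lemma radKer_zero : radKer d g 0 = 0 := by simp [radKer, radMass]

lemma radKer_abs (r : ℝ) : radKer d g |r| = radKer d g r := by simp [radKer, radMass]

lemma continuous_radKer (hd : 1 ≤ d) (hgi : Integrable fun x : Euc d => g ‖x‖)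
    (h0 : Tendsto (radKer d g) (𝓝[>] 0) (𝓝 0)) : Continuous (radKer d g) := by
  rw [continuous_iff_continuousAt]
  intro r
  rcases eq_or_ne r 0 with rfl | hr
  · rw [continuousAt_iff_punctured_nhds, radKer_zero]
    have h1 : Tendsto (fun r : ℝ => |r|) (𝓝[≠] 0) (𝓝[>] 0) := by
      refine tendsto_nhdsWithin_iff.2 ⟨?_, ?_⟩
      · have := (continuous_abs (G := ℝ)).tendsto 0
        rw [abs_zero] at this
        exact this.mono_left nhdsWithin_le_nhds
      · filter_upwards [self_mem_nhdsWithin] with r hr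
        exact abs_pos.2 hr
    have := h0.comp h1
    refine this.congr fun r => ?_
    exact radKer_abs r
  · have := (continuous_radMass hd hgi).continuousAt (x := r)
    unfold radKer
    refine this.div (by fun_prop) ?_
    have := abs_pos.2 hr
    positivity

lemma radMass_nonneg (hg0 : ∀ r, 0 ≤ g r) (r : ℝ) : 0 ≤ radMass d g r :=
  intervalIntegral.integral_nonneg (abs_nonneg r) fun τ hτ =>
    mul_nonneg (pow_nonneg hτ.1 _) (hg0 τ)

lemma radMass_le (hd : 1 ≤ d) (hg0 : ∀ r, 0 ≤ g r) (hgi : Integrable fun x : Euc d => g ‖x‖)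
    (hg1 : ∫ x : Euc d, g ‖x‖ = 1) (r : ℝ) : radMass d g r ≤ (sphArea d)⁻¹ := by
  have h := sphArea_mul_radMass (g := g) hd (abs_nonneg r)
  have h2 : radMass d g |r| = radMass d g r := by simp [radMass]
  rw [h2] at h
  have h3 : ∫ x in closedBall (0 : Euc d) |r|, g ‖x‖ ≤ 1 :=
    hg1 ▸ setIntegral_le_integral hgi (.of_forall fun x => hg0 _)
  have hs := sphArea_pos hd
  rw [← h] at h3
  rw [← one_div, le_div_iff₀ hs]
  linarith

lemma radMass_eq (hd : 1 ≤ d) (hg1 : ∫ x : Euc d, g ‖x‖ = 1) {a : ℝ}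
    (ha0 : 0 ≤ a) (ha : ∀ r, a < r → g r = 0) {r : ℝ} (hr : a ≤ r) :
    radMass d g r = (sphArea d)⁻¹ := by
  have h := sphArea_mul_radMass (g := g) hd (ha0.trans hr)
  rw [setIntegral_eq_integral_of_forall_compl_eq_zero, hg1] at h
  · exact eq_inv_of_mul_eq_one_right h
  · intro x hx
    rw [mem_closedBall_zero_iff, not_le] at hx
    exact ha _ (hr.trans_lt hx)

lemma radMass_le_of_le (hd : 1 ≤ d) (hgi : Integrable fun x : Euc d => g ‖x‖) {B : ℝ}
    (hB : ∀ r, g r ≤ B) {r : ℝ} (hr : 0 ≤ r) :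
    radMass d g r ≤ B / d * r ^ d := by
  rw [radMass, abs_of_nonneg hr]
  have hi : IntervalIntegrable (fun τ : ℝ => τ ^ (d - 1) * g τ) volume 0 r := by
    rw [intervalIntegrable_iff_integrableOn_Ioc_of_le hr]
    exact (radMass_integrable hd hgi).mono_set fun x hx => hx.1
  calc ∫ τ in (0 : ℝ)..r, τ ^ (d - 1) * g τ ≤ ∫ τ in (0 : ℝ)..r, τ ^ (d - 1) * B := by
        refine intervalIntegral.integral_mono_on hr hi
          (Continuous.intervalIntegrable (by fun_prop) _ _) fun τ hτ => ?_
        exact mul_le_mul_of_nonneg_left (hB τ) (pow_nonneg hτ.1 _)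
    _ = B / d * r ^ d := by
        obtain ⟨n, rfl⟩ : ∃ n, d = n + 1 := ⟨d - 1, by omega⟩
        rw [intervalIntegral.integral_mul_const, Nat.add_sub_cancel, integral_pow]
        push_cast
        ring

end profile

/-- The function `‖x‖^{1-d}` truncated to the unit ball. -/
def truncRiesz (d : ℕ) (x : Euc d) : ℝ := (Set.Iic 1).indicator (fun r : ℝ => (r ^ (d - 1))⁻¹) ‖x‖

lemma truncRiesz_nonneg {d : ℕ} (x : Euc d) : 0 ≤ truncRiesz d x := by
  unfold truncRiesz
  by_cases h : ‖x‖ ≤ 1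
  · rw [Set.indicator_of_mem (show ‖x‖ ∈ Set.Iic 1 from h)]; positivity
  · rw [Set.indicator_of_notMem (show ‖x‖ ∉ Set.Iic 1 from h)]

lemma truncRiesz_of_le {d : ℕ} {x : Euc d} (h : ‖x‖ ≤ 1) :
    truncRiesz d x = (‖x‖ ^ (d - 1))⁻¹ := by
  unfold truncRiesz
  rw [Set.indicator_of_mem (show ‖x‖ ∈ Set.Iic 1 from h)]

lemma integrable_truncRiesz {d : ℕ} (hd : 1 ≤ d) : Integrable (truncRiesz d) := by
  have : Nonempty (Fin d) := ⟨⟨0, hd⟩⟩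
  refine (integrable_fun_norm_addHaar (E := Euc d) volume
    (f := (Set.Iic 1).indicator (fun r : ℝ => (r ^ (d - 1))⁻¹))).2 ?_
  have h1 : IntegrableOn ((Set.Iic (1 : ℝ)).indicator (fun _ => (1 : ℝ))) (Set.Ioi 0) := by
    rw [IntegrableOn, integrable_indicator_iff measurableSet_Iic, IntegrableOn,
      Measure.restrict_restrict measurableSet_Iic, Set.inter_comm, Set.Ioi_inter_Iic]
    exact integrableOn_const (by simp)
  refine h1.congr_fun (fun y hy => ?_) measurableSet_Ioi
  have hy0 : (0 : ℝ) < y := hy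
  by_cases h : y ≤ 1
  · simp [Set.indicator, h, hy0.ne']
  · simp [Set.indicator, h]

/-- Radial kernels `k` that agree with the kernel `A r^{1-d}` of a point charge for `r ≥ a`
and are dominated by it everywhere. -/
structure IsKer (d : ℕ) (A a : ℝ) (k : ℝ → ℝ) : Prop where
  cont : Continuous k
  zero : k 0 = 0
  nonneg : ∀ r, 0 ≤ r → 0 ≤ k r
  le : ∀ r, 0 < r → k r ≤ A / r ^ (d - 1)
  eq : ∀ r, a ≤ r → k r = A / r ^ (d - 1)

lemma exists_dipole_bound (d : ℕ) (hd : 1 ≤ d) {A B : ℝ} (hA : 0 ≤ A) :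
    ∃ C : ℝ, 0 ≤ C ∧ ∀ k : ℝ → ℝ, IsKer d A (3 / 4) k → (∀ r, 0 ≤ r → k r ≤ B) →
      ∀ q : Euc d, ‖q‖ ≤ 1 / 2 → ∀ x : Euc d,
        ‖radField k (x - q) - radField k x‖ ≤ C * ((1 + ‖x‖) ^ d)⁻¹ := by
  refine ⟨2 * |B| * 3 ^ d + A * (2 ^ d + d * 2 ^ d * 2 ^ d) * 2 ^ d, by positivity,
    fun k hk hB q hq x => ?_⟩
  have hb : ∀ z : Euc d, ‖radField k z‖ ≤ |B| := fun z =>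
    (norm_radField_le k z).trans (by
      rw [abs_of_nonneg (hk.nonneg _ (norm_nonneg _))]
      exact (hB _ (norm_nonneg _)).trans (le_abs_self B))
  have hx1 : 0 < 1 + ‖x‖ := by positivity
  rw [← div_eq_mul_inv, le_div_iff₀ (by positivity)]
  rcases le_or_gt ‖x‖ 2 with hx | hx
  · have h1 : ‖radField k (x - q) - radField k x‖ ≤ 2 * |B| :=
      (norm_sub_le _ _).trans (by linarith [hb (x - q), hb x])
    have h2 : (1 + ‖x‖) ^ d ≤ 3 ^ d := by gcongr; linarith
    have h3 : 0 ≤ A * (2 ^ d + d * 2 ^ d * 2 ^ d) * 2 ^ d := by positivity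
    have := mul_le_mul h1 h2 (by positivity) (by positivity)
    linarith
  · obtain ⟨y, hy⟩ : ∃ y, y = x - q := ⟨_, rfl⟩
    rw [← hy]
    have hxy : ‖y - x‖ ≤ 1 / 2 := by simpa [hy] using hq
    have hyx : |‖y‖ - ‖x‖| ≤ 1 / 2 := (abs_norm_sub_norm_le y x).trans hxy
    obtain ⟨hyx1, hyx2⟩ := abs_le.1 hyx
    have hx0 : 0 < ‖x‖ := by linarith
    have hy0 : 0 < ‖y‖ := by linarith
    have hf : ∀ z : Euc d, 3 / 4 ≤ ‖z‖ → radField k z = (A / ‖z‖ ^ d) • z := by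
      intro z hz
      have hz0 : 0 < ‖z‖ := by linarith
      rw [radField, hk.eq _ hz]
      obtain ⟨n, rfl⟩ : ∃ n, d = n + 1 := ⟨d - 1, by omega⟩
      congr 1
      rw [Nat.add_sub_cancel]
      field_simp
      ring
    rw [hf y (by linarith), hf x (by linarith)]
    have hdec : (A / ‖y‖ ^ d) • y - (A / ‖x‖ ^ d) • x =
        (A / ‖y‖ ^ d) • (y - x) + (A / ‖y‖ ^ d - A / ‖x‖ ^ d) • x := by
      rw [smul_sub, sub_smul, sub_add_sub_cancel]
    have hylow : ‖x‖ / 2 ≤ ‖y‖ := by linarith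
    have hyup : ‖y‖ ≤ 2 * ‖x‖ := by linarith
    have t1 : A / ‖y‖ ^ d ≤ A * 2 ^ d / ‖x‖ ^ d := by
      calc A / ‖y‖ ^ d ≤ A / (‖x‖ / 2) ^ d := by gcongr
        _ = A * 2 ^ d / ‖x‖ ^ d := by rw [div_pow]; field_simp
    have t1' : 0 ≤ A / ‖y‖ ^ d := by positivity
    have n1 : ‖(A / ‖y‖ ^ d) • (y - x)‖ ≤ A * 2 ^ d / ‖x‖ ^ d := by
      rw [norm_smul, Real.norm_of_nonneg t1']
      calc A / ‖y‖ ^ d * ‖y - x‖ ≤ A / ‖y‖ ^ d * 1 := by gcongr; linarith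
        _ ≤ _ := by rw [mul_one]; exact t1
    have hpow : |‖x‖ ^ d - ‖y‖ ^ d| ≤ d * 2 ^ d * ‖x‖ ^ (d - 1) := by
      have h := abs_pow_sub_pow_le ‖x‖ ‖y‖ d
      have hm : max |‖x‖| |‖y‖| ≤ 2 * ‖x‖ := by
        rw [abs_norm, abs_norm]; exact max_le (by linarith) hyup
      calc |‖x‖ ^ d - ‖y‖ ^ d| ≤ |‖x‖ - ‖y‖| * d * max |‖x‖| |‖y‖| ^ (d - 1) := h
        _ ≤ 1 * d * (2 * ‖x‖) ^ (d - 1) := by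
            gcongr
            rw [abs_sub_comm]; linarith
        _ = d * 2 ^ (d - 1) * ‖x‖ ^ (d - 1) := by rw [mul_pow]; ring
        _ ≤ _ := by
            gcongr
            · norm_num
            · omega
    have n2 : ‖(A / ‖y‖ ^ d - A / ‖x‖ ^ d) • x‖ ≤ A * (d * 2 ^ d * 2 ^ d) / ‖x‖ ^ d := by
      have e : A / ‖y‖ ^ d - A / ‖x‖ ^ d = (A / ‖y‖ ^ d) * ((‖x‖ ^ d - ‖y‖ ^ d) / ‖x‖ ^ d) := by
        field_simp
      rw [e, norm_smul, norm_mul, Real.norm_of_nonneg t1', norm_div, Real.norm_eq_abs,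
        Real.norm_of_nonneg (show 0 ≤ ‖x‖ ^ d by positivity)]
      calc A / ‖y‖ ^ d * (|‖x‖ ^ d - ‖y‖ ^ d| / ‖x‖ ^ d) * ‖x‖
          ≤ A * 2 ^ d / ‖x‖ ^ d * ((d * 2 ^ d * ‖x‖ ^ (d - 1)) / ‖x‖ ^ d) * ‖x‖ := by gcongr
        _ = A * (d * 2 ^ d * 2 ^ d) / ‖x‖ ^ d := by
          obtain ⟨n, rfl⟩ : ∃ n, d = n + 1 := ⟨d - 1, by omega⟩
          rw [Nat.add_sub_cancel]
          field_simp
          ring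
    have n3 : ‖(A / ‖y‖ ^ d) • y - (A / ‖x‖ ^ d) • x‖ ≤
        A * (2 ^ d + d * 2 ^ d * 2 ^ d) / ‖x‖ ^ d := by
      rw [hdec]
      refine (norm_add_le _ _).trans ((add_le_add n1 n2).trans (le_of_eq ?_))
      ring
    have n4 : (1 + ‖x‖) ^ d ≤ 2 ^ d * ‖x‖ ^ d := by
      rw [← mul_pow]; gcongr; linarith
    have n5 : 0 ≤ 2 * |B| * 3 ^ d := by positivity
    refine le_trans ?_ (le_add_of_nonneg_left n5)
    calc _ ≤ A * (2 ^ d + d * 2 ^ d * 2 ^ d) / ‖x‖ ^ d * (2 ^ d * ‖x‖ ^ d) :=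
          mul_le_mul n3 n4 (by positivity) (by positivity)
      _ = _ := by field_simp

lemma radField_sub {d : ℕ} (k l : ℝ → ℝ) (x : Euc d) :
    radField (fun r => k r - l r) x = radField k x - radField l x := by
  simp only [radField, sub_div, sub_smul]

/-- The difference of the potentials generated by two kernels, normalised to vanish at `‖x‖ = 1`. -/
def diffPot {d : ℕ} (k l : ℝ → ℝ) (x : Euc d) : ℝ := ∫ r in ‖x‖..1, (k r - l r)

section diffPot

variable {d : ℕ} {A a b : ℝ} {k l : ℝ → ℝ}

lemma diffPot_eq (hk : Continuous k) (hl : Continuous l) (x : Euc d) :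
    diffPot k l x = (∫ r in (0 : ℝ)..1, (k r - l r)) + radPot (fun r => l r - k r) x := by
  have hi : ∀ a b, IntervalIntegrable (fun r => k r - l r) volume a b := fun a b =>
    (hk.sub hl).intervalIntegrable a b
  have h := intervalIntegral.integral_add_adjacent_intervals (hi 0 ‖x‖) (hi ‖x‖ 1)
  have h2 : radPot (fun r => l r - k r) x = - ∫ r in (0 : ℝ)..‖x‖, (k r - l r) := by
    rw [radPot, ← intervalIntegral.integral_neg]
    simp only [neg_sub]
  rw [diffPot, h2, ← h]
  ring

lemma hasGradientAt_diffPot (hk : IsKer d A a k) (hl : IsKer d A b l) (x : Euc d) :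
    HasGradientAt (diffPot k l) (radField l x - radField k x) x := by
  rw [← radField_sub]
  have h := hasGradientAt_radPot (d := d) (hl.cont.sub hk.cont) (by simp [hk.zero, hl.zero]) x
  have e : (diffPot k l : Euc d → ℝ) =
      fun x => (∫ r in (0 : ℝ)..1, (k r - l r)) + radPot (fun r => l r - k r) x :=
    funext fun x => diffPot_eq hk.cont hl.cont x
  rw [e, hasGradientAt_iff_hasFDerivAt]
  exact h.hasFDerivAt.const_add _

lemma contDiff_diffPot (hk : IsKer d A a k) (hl : IsKer d A b l) :
    ContDiff ℝ 1 (diffPot k l : Euc d → ℝ) :=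
  contDiff_one_of_hasGradientAt (hasGradientAt_diffPot hk hl)
    ((continuous_radField hl.cont hl.zero).sub (continuous_radField hk.cont hk.zero))

lemma diffPot_eq_zero (hk : IsKer d A a k) (hl : IsKer d A b l) {c : ℝ} (hc : c ≤ 1)
    (hac : a ≤ c) (hbc : b ≤ c) {x : Euc d} (hx : c ≤ ‖x‖) : diffPot k l x = 0 := by
  rw [diffPot, ← intervalIntegral.integral_zero (a := ‖x‖) (b := 1) (μ := volume)]
  refine intervalIntegral.integral_congr fun r hr => ?_
  have hr' : c ≤ r := (le_min hx hc).trans hr.1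
  simp [hk.eq r (hac.trans hr'), hl.eq r (hbc.trans hr')]

lemma norm_radField_sub_le (hk : IsKer d A a k) (hl : IsKer d A b l)
    (ha : a ≤ 1) (hb : b ≤ 1) (hA : 0 ≤ A) (x : Euc d) :
    ‖radField k x - radField l x‖ ≤ A * truncRiesz d x := by
  rw [← radField_sub]
  refine (norm_radField_le _ _).trans ?_
  rcases eq_or_lt_of_le (norm_nonneg x) with h0 | h0
  · rw [← h0, hk.zero, hl.zero]
    simpa using mul_nonneg hA (truncRiesz_nonneg x)
  rcases le_or_gt ‖x‖ 1 with h | h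
  · rw [truncRiesz_of_le h, ← div_eq_mul_inv, abs_le]
    have := hk.le _ h0
    have := hl.le _ h0
    have := hk.nonneg _ h0.le
    have := hl.nonneg _ h0.le
    constructor <;> linarith
  · rw [hk.eq _ (ha.trans h.le), hl.eq _ (hb.trans h.le), sub_self, abs_zero]
    exact mul_nonneg hA (truncRiesz_nonneg x)

lemma diffPot_le (hk : IsKer d A a k) (hl : IsKer d A b l)
    (ha : a ≤ 1) (hb : b ≤ 1) (hA : 0 ≤ A) {x : Euc d} (hx : x ≠ 0) :
    diffPot k l x ≤ A * truncRiesz d x := by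
  have h0 : 0 < ‖x‖ := norm_pos_iff.2 hx
  rcases le_or_gt ‖x‖ 1 with h | h
  · rw [truncRiesz_of_le h, ← div_eq_mul_inv, diffPot]
    calc ∫ r in ‖x‖..1, (k r - l r) ≤ ∫ r in ‖x‖..1, A / ‖x‖ ^ (d - 1) := by
          refine intervalIntegral.integral_mono_on h
            ((hk.cont.sub hl.cont).intervalIntegrable _ _) (by simp) fun r hr => ?_
          have hr0 : 0 < r := h0.trans_le hr.1
          have h1 := hk.le r hr0
          have h2 := hl.nonneg r hr0.le
          have h3 : A / r ^ (d - 1) ≤ A / ‖x‖ ^ (d - 1) := by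
            have := hr.1
            gcongr
          linarith
      _ = (1 - ‖x‖) * (A / ‖x‖ ^ (d - 1)) := by
          rw [intervalIntegral.integral_const, smul_eq_mul]
      _ ≤ 1 * (A / ‖x‖ ^ (d - 1)) := by gcongr; linarith
      _ = _ := one_mul _
  · rw [diffPot_eq_zero hk hl le_rfl ha hb h.le]
    exact mul_nonneg hA (truncRiesz_nonneg x)

lemma diffPot_nonneg (hk : IsKer d A a k) (hl : IsKer d A b l) (ha0 : 0 < a)
    (ha : a ≤ 1) (hb : b ≤ 1) {x : Euc d} (hx : a ≤ ‖x‖) : 0 ≤ diffPot k l x := by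
  rcases le_or_gt ‖x‖ 1 with h | h
  · refine intervalIntegral.integral_nonneg h fun r hr => ?_
    have hr' := hx.trans hr.1
    rw [hk.eq r hr']
    exact sub_nonneg.2 (hl.le r (ha0.trans_le hr'))
  · rw [diffPot_eq_zero hk hl le_rfl ha hb h.le]

lemma le_diffPot (hd : 2 ≤ d) (hk : IsKer d A a k) (hl : IsKer d A b l) (hA : 0 ≤ A) {B : ℝ}
    (hB : 0 ≤ B) (hlB : ∀ r, 0 ≤ r → l r ≤ B * r) {r₀ r₁ : ℝ} (hr₀ : r₀ ≤ 1)
    (hr₀B : B * r₀ ≤ A / 2) (ha0 : 0 < a) (ha : a ≤ r₁) (hr : r₁ ≤ r₀) {x : Euc d}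
    (hx : ‖x‖ ≤ r₁) : A / 2 * log (r₀ / r₁) - B ≤ diffPot k l x := by
  have hi : ∀ a b, IntervalIntegrable (fun r => k r - l r) volume a b := fun a b =>
    (hk.cont.sub hl.cont).intervalIntegrable a b
  have hr₁ : 0 < r₁ := ha0.trans_le ha
  have hr₀p : 0 < r₀ := hr₁.trans_le hr
  have s1 : -B ≤ ∫ r in ‖x‖..r₁, (k r - l r) := by
    calc -B ≤ (r₁ - ‖x‖) * (-B) := by
          have : r₁ - ‖x‖ ≤ 1 := by linarith [norm_nonneg x]
          nlinarith
      _ = ∫ r in ‖x‖..r₁, -B := by simp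
      _ ≤ _ := by
          refine intervalIntegral.integral_mono_on hx (by simp) (hi _ _) fun r hr' => ?_
          have h0 : 0 ≤ r := (norm_nonneg x).trans hr'.1
          have h1 := hk.nonneg r h0
          have h2 := hlB r h0
          have h3 : B * r ≤ B * 1 := by
            gcongr
            linarith [hr'.2]
          linarith
  have s2 : A / 2 * log (r₀ / r₁) ≤ ∫ r in r₁..r₀, (k r - l r) := by
    have h0 : (0 : ℝ) ∉ Set.uIcc r₁ r₀ := by
      rw [Set.uIcc_of_le hr]; exact fun h => absurd h.1 (not_le.2 hr₁)
    calc A / 2 * log (r₀ / r₁) = ∫ r in r₁..r₀, A / 2 * r⁻¹ := by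
          rw [intervalIntegral.integral_const_mul, integral_inv h0]
      _ ≤ _ := by
          refine intervalIntegral.integral_mono_on hr ?_ (hi _ _) fun r hr' => ?_
          · exact (intervalIntegral.intervalIntegrable_inv (fun x hx h => h0 (h ▸ hx))
              continuousOn_id).const_mul _
          have hrp : 0 < r := hr₁.trans_le hr'.1
          have hr1 : r ≤ 1 := hr'.2.trans hr₀
          have h1 := hk.eq r (ha.trans hr'.1)
          have h2 : l r ≤ A / 2 := (hlB r hrp.le).trans (le_trans (by gcongr; exact hr'.2) hr₀B)
          have h3 : r⁻¹ ≤ (r ^ (d - 1))⁻¹ := by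
            gcongr
            exact pow_le_of_le_one hrp.le hr1 (by omega)
          have h4 : 1 ≤ r⁻¹ := (one_le_inv₀ hrp).2 hr1
          rw [h1, div_eq_mul_inv A (r ^ (d - 1))]
          have h5 := mul_le_mul_of_nonneg_left h3 hA
          have h6 := mul_le_mul_of_nonneg_left h4 hA
          linarith
  have s3 : 0 ≤ ∫ r in r₀..1, (k r - l r) := by
    refine intervalIntegral.integral_nonneg hr₀ fun r hr' => ?_
    have hr'' := (ha.trans hr).trans hr'.1
    rw [hk.eq r hr'']
    exact sub_nonneg.2 (hl.le r (ha0.trans_le hr''))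
  rw [diffPot, ← intervalIntegral.integral_add_adjacent_intervals (hi ‖x‖ r₁) (hi r₁ 1),
    ← intervalIntegral.integral_add_adjacent_intervals (hi r₁ r₀) (hi r₀ 1)]
  linarith

end diffPot

/-- The profile of a radial function along the direction `e`. -/
def profile {d : ℕ} (e : Euc d) (f : Euc d → ℝ) (r : ℝ) : ℝ := f (r • e)

/-- Radial probability densities supported in the closed ball of radius `a`. -/
structure IsRadDensity {d : ℕ} (f : Euc d → ℝ) (a : ℝ) : Prop where
  meas : Measurable f
  nonneg : ∀ x, 0 ≤ f x
  radial : ∀ x y : Euc d, ‖x‖ = ‖y‖ → f x = f y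
  supp : ∀ x, a < ‖x‖ → f x = 0
  integral_eq : ∫ x, f x = 1

namespace IsRadDensity

variable {d : ℕ} {f : Euc d → ℝ} {a : ℝ} {e : Euc d}

lemma integrable (hf : IsRadDensity f a) : Integrable f := by
  by_contra h
  have := hf.integral_eq
  rw [integral_undef h] at this
  norm_num at this

lemma profile_norm (hf : IsRadDensity f a) (he : ‖e‖ = 1) (x : Euc d) :
    profile e f ‖x‖ = f x :=
  hf.radial _ _ (by rw [norm_smul, he, norm_norm, mul_one])

lemma measurable_profile (hf : IsRadDensity f a) : Measurable (profile e f) :=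
  hf.meas.comp (by fun_prop)

lemma integrable_profile (hf : IsRadDensity f a) (he : ‖e‖ = 1) :
    Integrable fun x : Euc d => profile e f ‖x‖ := by
  simp_rw [hf.profile_norm he]
  exact hf.integrable

lemma integral_profile (hf : IsRadDensity f a) (he : ‖e‖ = 1) :
    ∫ x : Euc d, profile e f ‖x‖ = 1 := by
  simp_rw [hf.profile_norm he]
  exact hf.integral_eq

lemma isKer (hf : IsRadDensity f a) (he : ‖e‖ = 1) (hd : 1 ≤ d) (ha : 0 < a)
    (h0 : Tendsto (radKer d (profile e f)) (𝓝[>] 0) (𝓝 0)) :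
    IsKer d (sphArea d)⁻¹ a (radKer d (profile e f)) where
  cont := continuous_radKer hd (hf.integrable_profile he) h0
  zero := radKer_zero
  nonneg r _ := div_nonneg (radMass_nonneg (fun _ => hf.nonneg _) r) (by positivity)
  le r hr := by
    rw [radKer, abs_of_pos hr]
    gcongr
    exact radMass_le (g := profile e f) hd (fun r => hf.nonneg (r • e)) (hf.integrable_profile he)
      (hf.integral_profile he) r
  eq r hr := by
    rw [radKer, abs_of_pos (ha.trans_le hr), radMass_eq hd (hf.integral_profile he) ha.le _ hr]
    intro s hs
    exact hf.supp _ (by rwa [norm_smul, he, mul_one, Real.norm_of_nonneg (ha.le.trans hs.le)])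

lemma radKer_le (hf : IsRadDensity f a) (he : ‖e‖ = 1) (hd : 1 ≤ d) {B : ℝ}
    (hB : ∀ x, f x ≤ B) {r : ℝ} (hr : 0 ≤ r) : radKer d (profile e f) r ≤ B / d * r := by
  rcases hr.eq_or_lt with rfl | hr
  · simp [radKer_zero]
  · have h := radMass_le_of_le hd (hf.integrable_profile he) (fun r => hB (r • e)) hr.le
    rw [radKer, abs_of_pos hr, div_le_iff₀ (by positivity)]
    refine h.trans (le_of_eq ?_)
    obtain ⟨n, rfl⟩ : ∃ n, d = n + 1 := ⟨d - 1, by omega⟩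
    rw [Nat.add_sub_cancel]
    ring

lemma tendsto_radKer (hf : IsRadDensity f a) (he : ‖e‖ = 1) (hd : 1 ≤ d) {B : ℝ}
    (hB : ∀ x, f x ≤ B) : Tendsto (radKer d (profile e f)) (𝓝[>] 0) (𝓝 0) := by
  have h1 : Tendsto (fun r : ℝ => B / d * r) (𝓝[>] 0) (𝓝 0) := by
    have : Continuous fun r : ℝ => B / d * r := by fun_prop
    have := this.tendsto 0
    rw [mul_zero] at this
    exact this.mono_left nhdsWithin_le_nhds
  refine tendsto_of_tendsto_of_tendsto_of_le_of_le' tendsto_const_nhds h1 ?_ ?_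
  · exact .of_forall fun r =>
      div_nonneg (radMass_nonneg (fun _ => hf.nonneg _) r) (by positivity)
  · filter_upwards [self_mem_nhdsWithin] with r hr
    exact hf.radKer_le he hd hB (le_of_lt hr)

lemma integral_inner_radField_sub (hf : IsRadDensity f a) (he : ‖e‖ = 1) (hd : 1 ≤ d)
    {φ : Euc d → ℝ} (hφ : ContDiff ℝ 1 φ) (hc : HasCompactSupport φ) (p : Euc d) :
    ∫ x, ⟪radField (radKer d (profile e f)) (x - p), gradient φ x⟫ = - ∫ x, f (x - p) * φ x := by
  have hψ : ContDiff ℝ 1 fun x => φ (x + p) := hφ.comp (contDiff_id.add contDiff_const)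
  have hψc : HasCompactSupport fun x => φ (x + p) := hc.comp_homeomorph (Homeomorph.addRight p)
  have h := integral_inner_radField hd (hf.measurable_profile (e := e))
    (hf.integrable_profile he) hψ hψc
  have hg : ∀ x, gradient (fun x => φ (x + p)) x = gradient φ (x + p) := by
    intro x
    unfold gradient
    rw [fderiv_comp_add_right]
  simp_rw [hg, hf.profile_norm he] at h
  rw [← integral_sub_right_eq_self (fun x => ⟪radField (radKer d (profile e f)) x,
    gradient φ (x + p)⟫) p, ← integral_sub_right_eq_self (fun x => f x * φ (x + p)) p] at h
  simpa using h

end IsRadDensity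

/-- The uniform probability measure on the ball of radius `1/2`. -/
def ballProb (d : ℕ) : Measure (Euc d) :=
  (volume (closedBall (0 : Euc d) (1 / 2)))⁻¹ • volume.restrict (closedBall (0 : Euc d) (1 / 2))

lemma volume_closedBall_ne_zero (d : ℕ) : volume (closedBall (0 : Euc d) (1 / 2)) ≠ 0 :=
  (measure_closedBall_pos _ _ (by norm_num)).ne'

lemma volume_closedBall_ne_top (d : ℕ) : volume (closedBall (0 : Euc d) (1 / 2)) ≠ ∞ :=
  measure_closedBall_lt_top.ne

instance (d : ℕ) : IsProbabilityMeasure (ballProb d) := by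
  constructor
  rw [ballProb, Measure.smul_apply, Measure.restrict_apply_univ, smul_eq_mul,
    ENNReal.inv_mul_cancel (volume_closedBall_ne_zero d) (volume_closedBall_ne_top d)]

lemma ballProb_compl (d : ℕ) : ballProb d (closedBall (0 : Euc d) (1 / 2))ᶜ = 0 := by
  rw [ballProb, Measure.smul_apply, Measure.restrict_apply measurableSet_closedBall.compl]
  simp

lemma ae_ballProb (d : ℕ) : ∀ᵐ q ∂ballProb d, ‖q‖ ≤ 1 / 2 := by
  rw [ae_iff]
  convert ballProb_compl d using 2
  ext q
  simp

lemma integral_ballProb {d : ℕ} (u : Euc d → ℝ) : ∫ q, u q ∂ballProb d =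
    (volume (closedBall (0 : Euc d) (1 / 2))).toReal⁻¹ *
      ∫ q, (closedBall (0 : Euc d) (1 / 2)).indicator u q := by
  rw [ballProb, integral_smul_measure, integral_indicator measurableSet_closedBall,
    ENNReal.toReal_inv, smul_eq_mul]

/-- The average of a density over translations in the ball of radius `1/2`. -/
def ballAvg {d : ℕ} (f : Euc d → ℝ) (x : Euc d) : ℝ := ∫ q, f (x - q) ∂ballProb d

namespace IsRadDensity

variable {d : ℕ} {f : Euc d → ℝ} {a : ℝ}

lemma integrable_sub_mul (hf : IsRadDensity f a) {φ : Euc d → ℝ} (hφ : Measurable φ) {C : ℝ}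
    (hC : ∀ x, ‖φ x‖ ≤ C) :
    Integrable (fun z : Euc d × Euc d => f (z.1 - z.2) * φ z.1) (volume.prod (ballProb d)) := by
  have hm : Measurable fun z : Euc d × Euc d => f (z.1 - z.2) * φ z.1 :=
    (hf.meas.comp (measurable_fst.sub measurable_snd)).mul (hφ.comp measurable_fst)
  rw [integrable_prod_iff' hm.aestronglyMeasurable]
  have hi : ∀ q, Integrable fun x => f (x - q) := fun q => hf.integrable.comp_sub_right q
  constructor
  · refine .of_forall fun q => ?_
    exact (hi q).mul_bdd (c := C) hφ.aestronglyMeasurable (.of_forall hC)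
  · refine Integrable.mono' (integrable_const C)
      (hm.norm.stronglyMeasurable.integral_prod_left').aestronglyMeasurable
      (.of_forall fun q => ?_)
    rw [Real.norm_of_nonneg (integral_nonneg fun _ => norm_nonneg _)]
    calc ∫ x, ‖f (x - q) * φ x‖ ≤ ∫ x, f (x - q) * C := by
          refine integral_mono_of_nonneg (.of_forall fun _ => norm_nonneg _)
            ((hi q).mul_const C) (.of_forall fun x => ?_)
          simp only [norm_mul, Real.norm_of_nonneg (hf.nonneg _)]
          exact mul_le_mul_of_nonneg_left (hC x) (hf.nonneg _)
      _ = C := by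
          rw [integral_mul_const, integral_sub_right_eq_self f q, hf.integral_eq, one_mul]

lemma integral_ballAvg_mul (hf : IsRadDensity f a) {φ : Euc d → ℝ} (hφ : Measurable φ) {C : ℝ}
    (hC : ∀ x, ‖φ x‖ ≤ C) :
    ∫ x, ballAvg f x * φ x = ∫ q, ∫ x, f (x - q) * φ x ∂volume ∂ballProb d := by
  rw [← integral_integral_swap (f := fun x q => f (x - q) * φ x) (hf.integrable_sub_mul hφ hC)]
  simp_rw [integral_mul_const]
  rfl

lemma ballAvg_le (hf : IsRadDensity f a) (x : Euc d) :
    ballAvg f x ≤ (volume (closedBall (0 : Euc d) (1 / 2))).toReal⁻¹ := by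
  rw [ballAvg, integral_ballProb]
  refine mul_le_of_le_one_right (by positivity) ?_
  rw [integral_indicator measurableSet_closedBall]
  calc ∫ q in closedBall (0 : Euc d) (1 / 2), f (x - q) ≤ ∫ q, f (x - q) :=
        setIntegral_le_integral (hf.integrable.comp_sub_left x) (.of_forall fun q => hf.nonneg _)
    _ = 1 := by rw [integral_sub_left_eq_self f volume x, hf.integral_eq]

lemma ballAvg_isRadDensity (hf : IsRadDensity f a) : IsRadDensity (ballAvg f) (a + 1 / 2) where
  meas := by
    have hm : Measurable fun z : Euc d × Euc d => f (z.1 - z.2) :=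
      hf.meas.comp (measurable_fst.sub measurable_snd)
    exact (hm.stronglyMeasurable.integral_prod_right').measurable
  nonneg x := integral_nonneg fun q => hf.nonneg _
  radial x y hxy := by
    let O : Euc d ≃ₗᵢ[ℝ] Euc d := (Submodule.span ℝ {x - y})ᗮ.reflection
    have hO : O x = y := Submodule.reflection_sub hxy
    rw [ballAvg, ballAvg, integral_ballProb, integral_ballProb, ← hO]
    congr 1
    symm
    rw [← O.measurePreserving.integral_comp O.toHomeomorph.measurableEmbedding]
    congr 1
    funext q
    simp only [Set.indicator, mem_closedBall_zero_iff, O.norm_map]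
    split_ifs
    · refine hf.radial _ _ ?_
      rw [← map_sub, O.norm_map]
    · rfl
  supp x hx := by
    rw [ballAvg, integral_eq_zero_of_ae]
    filter_upwards [ae_ballProb d] with q hq
    refine hf.supp _ ?_
    have := norm_sub_norm_le x q
    linarith
  integral_eq := by
    have h := hf.integral_ballAvg_mul (φ := fun _ => 1) measurable_const (C := 1) (by simp)
    simp only [mul_one] at h
    rw [h]
    have h1 : ∀ q, ∫ x, f (x - q) = 1 := fun q => by
      rw [integral_sub_right_eq_self f q, hf.integral_eq]
    simp [h1]

end IsRadDensity

lemma isRadDensity_smear {d : ℕ} {ρ : Euc d → ℝ} (hρmeas : Measurable ρ)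
    (hρnonneg : ∀ x, 0 ≤ ρ x) (hρradial : ∀ x y : Euc d, ‖x‖ = ‖y‖ → ρ x = ρ y)
    (hρsupp : Function.support ρ ⊆ closedBall 0 1) (hρint : ∫ x, ρ x = 1) {η : ℝ} (hη : 0 < η) :
    IsRadDensity (smear d ρ η 0) η where
  meas := by unfold smear; exact (hρmeas.comp (by fun_prop)).const_mul _
  nonneg x := mul_nonneg (by positivity) (hρnonneg _)
  radial x y hxy := by
    unfold smear
    rw [hρradial (η⁻¹ • (x - 0)) (η⁻¹ • (y - 0)) (by simp [norm_smul, hxy])]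
  supp x hx := by
    unfold smear
    have : η⁻¹ • (x - 0) ∉ Function.support ρ := fun h => by
      have := hρsupp h
      rw [mem_closedBall_zero_iff, norm_smul, sub_zero, norm_inv, Real.norm_of_nonneg hη.le,
        inv_mul_le_iff₀ hη, mul_one] at this
      exact absurd hx (not_lt.2 this)
    rw [Function.notMem_support.1 this, mul_zero]
  integral_eq := by
    unfold smear
    simp only [sub_zero]
    rw [integral_const_mul, Measure.integral_comp_inv_smul_of_nonneg volume ρ hη.le, hρint,
      finrank_euclideanSpace_fin, smul_eq_mul, mul_one, inv_mul_cancel₀ (by positivity)]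

lemma smear_eq_sub {d : ℕ} (ρ : Euc d → ℝ) (η : ℝ) (p x : Euc d) :
    smear d ρ η p x = smear d ρ η 0 (x - p) := by
  simp [smear]

lemma ball_subset_interior {E : Type*} [NormedAddCommGroup E] [NormedSpace ℝ E]
    {K : Set E} (hK : IsClosed K) {p : E} (hp : p ∈ K) {r : ℝ} (hr : 0 < r)
    (h : r ≤ infDist p (frontier K)) : ball p r ⊆ interior K := by
  have hdisj : ∀ x ∈ ball p r, x ∉ frontier K := by
    intro x hx hxf
    have := infDist_le_dist_of_mem (x := p) hxf
    rw [mem_ball, dist_comm] at hx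
    linarith
  have hsub : ball p r ⊆ interior K ∪ Kᶜ := by
    intro x hx
    by_cases hxK : x ∈ K
    · left
      by_contra hxi
      exact hdisj x hx (by rw [hK.frontier_eq]; exact ⟨hxK, hxi⟩)
    · exact .inr hxK
  have hpi : p ∈ interior K := by
    rcases hsub (mem_ball_self hr) with h | h
    · exact h
    · exact absurd hp h
  exact (convex_ball p r).isPreconnected.subset_left_of_subset_union isOpen_interior
    hK.isOpen_compl (disjoint_compl_right.mono_left interior_subset) hsub
    ⟨p, mem_ball_self hr, hpi⟩

lemma norm_gradient_sub {d : ℕ} (f g : Euc d → ℝ) (x : Euc d) :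
    ‖gradient f x - gradient g x‖ = ‖fderiv ℝ f x - fderiv ℝ g x‖ := by
  rw [gradient, gradient, ← map_sub, LinearIsometryEquiv.norm_map]

lemma continuous_gradient {d : ℕ} {f : Euc d → ℝ} (hf : ContDiff ℝ 1 f) :
    Continuous (gradient f) :=
  (LinearIsometryEquiv.continuous _).comp (hf.continuous_fderiv one_ne_zero)

lemma gradient_eq_zero_of_notMem_tsupport {d : ℕ} {f : Euc d → ℝ} {x : Euc d}
    (hx : x ∉ tsupport f) : gradient f x = 0 := by
  have : fderiv ℝ f x = 0 := by
    by_contra h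
    exact hx (support_fderiv_subset ℝ h)
  rw [gradient, this, map_zero]

/-- A compactly supported `C¹` function is `C¹`-close to a smooth function with nearby support. -/
lemma exists_smooth_approx {d : ℕ} {φ : Euc d → ℝ} (hφ : ContDiff ℝ 1 φ)
    (hc : HasCompactSupport φ) {δ ε : ℝ} (hδ : 0 < δ) (hε : 0 < ε) :
    ∃ ψ : Euc d → ℝ, ContDiff ℝ (⊤ : ℕ∞) ψ ∧ HasCompactSupport ψ ∧
      tsupport ψ ⊆ cthickening δ (tsupport φ) ∧ (∀ x, |ψ x - φ x| ≤ ε) ∧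
      ∀ x, ‖gradient ψ x - gradient φ x‖ ≤ ε := by
  obtain ⟨δ₁, hδ₁, h₁⟩ := Metric.uniformContinuous_iff.1
    (hc.uniformContinuous_of_continuous hφ.continuous) ε hε
  obtain ⟨δ₂, hδ₂, h₂⟩ := Metric.uniformContinuous_iff.1
    ((hc.fderiv ℝ).uniformContinuous_of_continuous (hφ.continuous_fderiv one_ne_zero)) ε hε
  set r := min δ (min δ₁ δ₂) with hr
  have hr0 : 0 < r := by positivity
  let χ : ContDiffBump (0 : Euc d) := ⟨r / 2, r, by positivity, by linarith⟩
  let ψ : Euc d → ℝ := MeasureTheory.convolution (χ.normed volume) φ (ContinuousLinearMap.lsmul ℝ ℝ)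
    volume
  have hχc : HasCompactSupport (χ.normed volume) := χ.hasCompactSupport_normed
  have hχs : ContDiff ℝ (⊤ : ℕ∞) (χ.normed volume) := χ.contDiff_normed
  have hsupp : tsupport ψ ⊆ cthickening δ (tsupport φ) := by
    refine closure_minimal ?_ isClosed_cthickening
    intro x hx
    obtain ⟨y, hy, z, hz, rfl⟩ := support_convolution_subset_swap _ hx
    rw [χ.support_normed_eq, mem_ball_zero_iff] at hz
    refine mem_cthickening_of_dist_le _ y _ _ (subset_closure hy) ?_
    simp only [dist_eq_norm, add_sub_cancel_left]
    exact hz.le.trans (min_le_left _ _)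
  refine ⟨ψ, hχc.contDiff_convolution_left _ hχs hφ.continuous.locallyIntegrable,
    HasCompactSupport.of_support_subset_isCompact hc.isCompact.cthickening
      (subset_closure.trans hsupp), hsupp, fun x => ?_, fun x => ?_⟩
  · rw [← Real.dist_eq]
    refine χ.dist_normed_convolution_le hφ.continuous.aestronglyMeasurable fun y hy => ?_
    exact (h₁ ((mem_ball.1 hy).trans_le ((min_le_right _ _).trans (min_le_left _ _)))).le
  · have hd := hc.hasFDerivAt_convolution_right (ContinuousLinearMap.lsmul ℝ ℝ)
      (hχs.continuous.locallyIntegrable (μ := volume)) hφ x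
    rw [norm_gradient_sub, hd.fderiv, ← dist_eq_norm]
    have hL : ((ContinuousLinearMap.lsmul ℝ ℝ : ℝ →L[ℝ] ℝ →L[ℝ] ℝ).precompR (Euc d)) =
        ContinuousLinearMap.lsmul ℝ ℝ := by
      ext a T
      simp
    rw [hL]
    refine χ.dist_normed_convolution_le
      (hφ.continuous_fderiv one_ne_zero).aestronglyMeasurable fun y hy => ?_
    exact (h₂ ((mem_ball.1 hy).trans_le ((min_le_right _ _).trans (min_le_right _ _)))).le

lemma integrable_inner_gradient {d : ℕ} {U : Set (Euc d)}
    {V : Euc d → Euc d} (hV : ContinuousOn V U) {φ : Euc d → ℝ} (hφ : ContDiff ℝ 1 φ)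
    (hc : HasCompactSupport φ) (hs : tsupport φ ⊆ U) :
    Integrable fun x => ⟪V x, gradient φ x⟫ := by
  have hi : IntegrableOn (fun x => ⟪V x, gradient φ x⟫) (tsupport φ) :=
    ((hV.mono hs).inner (continuous_gradient hφ).continuousOn).integrableOn_compact hc.isCompact
  refine (integrableOn_iff_integrable_of_support_subset ?_).1 hi
  intro x hx
  by_contra h
  exact hx (by simp [gradient_eq_zero_of_notMem_tsupport h])

/-- A weak identity `-div V = g` on `U` extends from smooth to `C¹` test functions. -/
lemma integral_inner_gradient_of_smooth {d : ℕ} {U : Set (Euc d)} (hU : IsOpen U)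
    {V : Euc d → Euc d} (hV : ContinuousOn V U) {g : Euc d → ℝ} (hg : LocallyIntegrable g)
    (hw : ∀ φ : Euc d → ℝ, ContDiff ℝ (⊤ : ℕ∞) φ → HasCompactSupport φ → tsupport φ ⊆ U →
      ∫ x, ⟪V x, gradient φ x⟫ = ∫ x, g x * φ x)
    {φ : Euc d → ℝ} (hφ : ContDiff ℝ 1 φ) (hc : HasCompactSupport φ) (hs : tsupport φ ⊆ U) :
    ∫ x, ⟪V x, gradient φ x⟫ = ∫ x, g x * φ x := by
  obtain ⟨δ, hδ, hδU⟩ := hc.isCompact.exists_cthickening_subset_open hU hs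
  set S := cthickening δ (tsupport φ) with hS
  have hSc : IsCompact S := hc.isCompact.cthickening
  have hVS : IntegrableOn (fun x => ‖V x‖) S := (hV.mono hδU).norm.integrableOn_compact hSc
  have hgS : IntegrableOn (fun x => |g x|) S := (hg.integrableOn_isCompact hSc).norm
  have hgφ : ∀ ψ : Euc d → ℝ, Continuous ψ → HasCompactSupport ψ →
      Integrable fun x => g x * ψ x := by
    intro ψ hψ hψc
    simpa [smul_eq_mul, mul_comm] using hg.integrable_smul_left_of_hasCompactSupport hψ hψc
  refine eq_of_abs_sub_le_all fun ε hε => ?_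
  set M := (∫ x in S, ‖V x‖) + ∫ x in S, |g x| with hM
  have hM0 : 0 ≤ M := add_nonneg (integral_nonneg fun _ => norm_nonneg _)
    (integral_nonneg fun _ => abs_nonneg _)
  obtain ⟨ψ, hψ, hψc, hψs, h0, h1⟩ := exists_smooth_approx hφ hc hδ
    (show 0 < ε / (M + 1) by positivity)
  have hψ1 : ContDiff ℝ 1 ψ := hψ.of_le (by exact_mod_cast le_top)
  have hsS : tsupport φ ⊆ S := self_subset_cthickening _
  have e1 : |(∫ x, ⟪V x, gradient ψ x⟫) - ∫ x, ⟪V x, gradient φ x⟫| ≤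
      ε / (M + 1) * ∫ x in S, ‖V x‖ := by
    rw [← integral_sub (integrable_inner_gradient hV hψ1 hψc (hψs.trans hδU))
      (integrable_inner_gradient hV hφ hc hs), ← integral_const_mul,
      ← integral_indicator hSc.measurableSet, ← Real.norm_eq_abs]
    refine norm_integral_le_of_norm_le
      ((integrable_indicator_iff hSc.measurableSet).2 (hVS.const_mul _))
      (.of_forall fun x => ?_)
    by_cases hx : x ∈ S
    · rw [Set.indicator_of_mem hx, ← inner_sub_right, mul_comm]
      exact (norm_inner_le_norm _ _).trans
        (mul_le_mul_of_nonneg_left (h1 x) (norm_nonneg _))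
    · rw [gradient_eq_zero_of_notMem_tsupport fun h => hx (hψs h),
        gradient_eq_zero_of_notMem_tsupport fun h => hx (hsS h)]
      simp [hx]
  have e2 : |(∫ x, g x * ψ x) - ∫ x, g x * φ x| ≤ ε / (M + 1) * ∫ x in S, |g x| := by
    rw [← integral_sub (hgφ ψ hψ1.continuous hψc) (hgφ φ hφ.continuous hc), ← integral_const_mul,
      ← integral_indicator hSc.measurableSet, ← Real.norm_eq_abs]
    refine norm_integral_le_of_norm_le
      ((integrable_indicator_iff hSc.measurableSet).2 (hgS.const_mul _))
      (.of_forall fun x => ?_)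
    by_cases hx : x ∈ S
    · rw [Set.indicator_of_mem hx, ← mul_sub, mul_comm (ε / (M + 1)), norm_mul]
      exact mul_le_mul_of_nonneg_left (h0 x) (norm_nonneg _)
    · rw [image_eq_zero_of_notMem_tsupport fun h => hx (hψs h),
        image_eq_zero_of_notMem_tsupport fun h => hx (hsS h)]
      simp [hx]
  rw [hw ψ hψ hψc (hψs.trans hδU)] at e1
  have e3 : ε / (M + 1) * (∫ x in S, ‖V x‖) + ε / (M + 1) * (∫ x in S, |g x|) ≤ ε := by
    rw [← mul_add, div_mul_eq_mul_div, div_le_iff₀ (by positivity)]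
    nlinarith
  rw [abs_le] at e1 e2 ⊢
  constructor <;> linarith [e1.1, e1.2, e2.1, e2.2]

lemma gradient_comp_smul_sub {d : ℕ} {χ : Euc d → ℝ} (hχ : Differentiable ℝ χ) (s : ℝ)
    (p x : Euc d) : gradient (fun y => χ (s • (y - p))) x = s • gradient χ (s • (x - p)) := by
  have h : HasFDerivAt (fun y : Euc d => s • (y - p)) (s • ContinuousLinearMap.id ℝ (Euc d)) x :=
    ((hasFDerivAt_id x).sub_const p).const_smul s
  have h2 := (hχ (s • (x - p))).hasFDerivAt.comp x h
  have h3 : fderiv ℝ (fun y => χ (s • (y - p))) x = s • fderiv ℝ χ (s • (x - p)) := by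
    refine h2.fderiv.trans ?_
    ext v
    simp
  rw [gradient, h3, gradient, map_smulₛₗ]
  rfl

lemma integral_comp_smul_sub {d : ℕ} (u : Euc d → ℝ) {r : ℝ} (hr : 0 < r) (p : Euc d) :
    ∫ x, u (r⁻¹ • (x - p)) = r ^ d * ∫ x, u x := by
  rw [integral_sub_right_eq_self (fun x => u (r⁻¹ • x)) p,
    Measure.integral_comp_inv_smul_of_nonneg volume u hr.le, finrank_euclideanSpace_fin, smul_eq_mul]

/-- Quantitative bound on the radial kernel of a density dominated by the divergence of a
continuous field. -/
lemma exists_radKer_le_of_weak {d : ℕ} (hd : 1 ≤ d) {f : Euc d → ℝ} {a : ℝ}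
    (hf : IsRadDensity f a) {e : Euc d} (he : ‖e‖ = 1) {U : Set (Euc d)} (hU : IsOpen U)
    {p : Euc d} (hp : p ∈ U) {V : Euc d → Euc d} (hV : ContinuousOn V U) {c : ℝ} (hc : 0 < c)
    {m : Euc d → ℝ} (hm : LocallyIntegrable m) (hmf : ∀ x, f (x - p) ≤ m x)
    (hw : ∀ φ : Euc d → ℝ, ContDiff ℝ (⊤ : ℕ∞) φ → HasCompactSupport φ → tsupport φ ⊆ U →
      ∫ x, ⟪V x, gradient φ x⟫ = ∫ x, c * (m x - 1) * φ x) :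
    ∃ M I : ℝ, 0 ≤ M ∧ 0 ≤ I ∧ ∀ ε > 0, ∀ᶠ r in 𝓝[>] (0 : ℝ),
      radKer d (profile e f) r ≤ (sphArea d)⁻¹ * (ε * M / c + r * I) := by
  let χ : ContDiffBump (0 : Euc d) := ⟨1, 2, one_pos, one_lt_two⟩
  have hχs : ContDiff ℝ (⊤ : ℕ∞) χ := χ.contDiff
  have hχ1 : ContDiff ℝ 1 χ := χ.contDiff
  have hχd : Differentiable ℝ χ := hχ1.differentiable one_ne_zero
  have hGi : Integrable (gradient χ) :=
    (continuous_gradient hχ1).integrable_of_hasCompactSupport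
      (χ.hasCompactSupport.fderiv ℝ |>.comp_left (g := (InnerProductSpace.toDual ℝ (Euc d)).symm)
        (map_zero _))
  set M := ∫ x, ‖gradient χ x‖ with hM
  set I := ∫ x, χ x with hI
  have hM0 : 0 ≤ M := integral_nonneg fun _ => norm_nonneg _
  have hI0 : 0 ≤ I := integral_nonneg fun _ => χ.nonneg
  have hodd : ∀ x, gradient χ (-x) = - gradient χ x := by
    intro x
    have h := gradient_comp_smul_sub hχd (-1) 0 x
    have h2 : (fun y : Euc d => χ ((-1 : ℝ) • (y - 0))) = χ := by
      funext y
      simp [χ.neg]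
    rw [h2] at h
    simp only [sub_zero, neg_smul, one_smul] at h
    rw [h, neg_neg]
  have hzero : ∀ v : Euc d, ∫ x, ⟪v, gradient χ x⟫ = 0 := by
    intro v
    have h := integral_neg_eq_self (fun x => ⟪v, gradient χ x⟫) volume
    simp_rw [hodd, inner_neg_right] at h
    rw [integral_neg] at h
    linarith
  refine ⟨M, I, hM0, hI0, ?_⟩
  intro ε hε
  have hVp : ContinuousAt V p := hV.continuousAt (hU.mem_nhds hp)
  obtain ⟨δ, hδ, hδV⟩ := Metric.eventually_nhds_iff.1
    ((Metric.continuousAt_iff'.1 hVp ε hε).and (hU.mem_nhds hp))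
  filter_upwards [Ioo_mem_nhdsGT (show (0 : ℝ) < δ / 2 by positivity)] with r hr
  obtain ⟨hr0, hr1⟩ := hr
  let φ : Euc d → ℝ := fun x => χ (r⁻¹ • (x - p))
  have hφs : ContDiff ℝ (⊤ : ℕ∞) φ := hχs.comp (by fun_prop)
  have hφ1 : ContDiff ℝ 1 φ := hφs.of_le (by exact_mod_cast le_top)
  have hφ0 : ∀ x, 2 * r < dist x p → φ x = 0 := by
    intro x hx
    refine χ.zero_of_le_dist ?_
    rw [dist_zero_right, norm_smul, norm_inv, Real.norm_of_nonneg hr0.le, ← dist_eq_norm,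
      le_inv_mul_iff₀ hr0]
    change r * 2 ≤ _
    linarith
  have hts : tsupport φ ⊆ closedBall p (2 * r) := by
    refine closure_minimal (fun x hx => ?_) isClosed_closedBall
    by_contra h
    exact hx (hφ0 x (by simpa using h))
  have hφc : HasCompactSupport φ :=
    HasCompactSupport.of_support_subset_isCompact (isCompact_closedBall p (2 * r))
      (subset_closure.trans hts)
  have hball : ∀ x ∈ closedBall p (2 * r), ‖V x - V p‖ < ε ∧ x ∈ U := by
    intro x hx
    have := hδV (y := x) ((mem_closedBall.1 hx).trans_lt (by linarith))
    rwa [dist_eq_norm] at this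
  have htsU : tsupport φ ⊆ U := fun x hx => (hball x (hts hx)).2
  have hg : ∀ x, gradient φ x = r⁻¹ • gradient χ (r⁻¹ • (x - p)) :=
    gradient_comp_smul_sub hχd r⁻¹ p
  have hpow : r ^ d * r⁻¹ = r ^ (d - 1) := by
    obtain ⟨n, rfl⟩ : ∃ n, d = n + 1 := ⟨d - 1, by omega⟩
    rw [Nat.add_sub_cancel, pow_succ]
    field_simp
  have hgn : ∫ x, ‖gradient φ x‖ = r ^ (d - 1) * M := by
    simp_rw [hg, norm_smul, norm_inv, Real.norm_of_nonneg hr0.le]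
    rw [integral_const_mul, integral_comp_smul_sub (fun x => ‖gradient χ x‖) hr0, ← hpow]
    ring
  have hg0 : ∫ x, ⟪V p, gradient φ x⟫ = 0 := by
    simp_rw [hg, inner_smul_right]
    rw [integral_const_mul, integral_comp_smul_sub (fun x => ⟪V p, gradient χ x⟫) hr0, hzero]
    simp
  have hgφi : Integrable fun x => ‖gradient φ x‖ := by
    have := integrable_inner_gradient (U := Set.univ) (V := fun _ => V p)
      continuousOn_const hφ1 hφc (Set.subset_univ _)
    refine Continuous.integrable_of_hasCompactSupport (continuous_gradient hφ1).norm ?_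
    refine HasCompactSupport.of_support_subset_isCompact hφc.isCompact fun x hx => ?_
    by_contra h
    exact hx (by simp [gradient_eq_zero_of_notMem_tsupport h])
  have hupper : ∫ x, ⟪V x, gradient φ x⟫ ≤ ε * (r ^ (d - 1) * M) := by
    rw [← hgn, ← integral_const_mul, ← sub_zero (∫ x, ⟪V x, gradient φ x⟫), ← hg0,
      ← integral_sub (integrable_inner_gradient hV hφ1 hφc htsU)
        (integrable_inner_gradient (U := Set.univ) (V := fun _ => V p)
          continuousOn_const hφ1 hφc (Set.subset_univ _))]
    refine integral_mono ((integrable_inner_gradient hV hφ1 hφc htsU).sub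
        (integrable_inner_gradient (U := Set.univ) (V := fun _ => V p)
          continuousOn_const hφ1 hφc (Set.subset_univ _))) (hgφi.const_mul _) fun x => ?_
    by_cases hx : x ∈ closedBall p (2 * r)
    · change ⟪V x, gradient φ x⟫ - ⟪V p, gradient φ x⟫ ≤ _
      rw [← inner_sub_left]
      exact (real_inner_le_norm _ _).trans
        (mul_le_mul_of_nonneg_right (hball x hx).1.le (norm_nonneg _))
    · simp [gradient_eq_zero_of_notMem_tsupport fun h => hx (hts h)]
  have hmφ : Integrable fun x => m x * φ x := by
    simpa [smul_eq_mul, mul_comm] using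
      hm.integrable_smul_left_of_hasCompactSupport hφs.continuous hφc
  have hφi : Integrable φ := hφs.continuous.integrable_of_hasCompactSupport hφc
  have hI' : ∫ x, φ x = r ^ d * I := integral_comp_smul_sub (fun x => χ x) hr0 p
  have hlow : sphArea d * radMass d (profile e f) r ≤ ∫ x, m x * φ x := by
    rw [sphArea_mul_radMass hd hr0.le]
    simp_rw [hf.profile_norm he]
    rw [← integral_indicator measurableSet_closedBall,
      ← integral_sub_right_eq_self _ p]
    refine integral_mono_of_nonneg (.of_forall fun x =>
      Set.indicator_nonneg (fun _ _ => hf.nonneg _) _) hmφ (.of_forall fun x => ?_)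
    by_cases hx : x - p ∈ closedBall (0 : Euc d) r
    · have h1 : φ x = 1 := by
        refine χ.one_of_mem_closedBall ?_
        rw [mem_closedBall_zero_iff] at hx ⊢
        rw [norm_smul, norm_inv, Real.norm_of_nonneg hr0.le, inv_mul_le_iff₀ hr0]
        change _ ≤ r * 1
        linarith
      simp only [Set.indicator_of_mem hx, h1, mul_one]
      exact hmf x
    · simp only [Set.indicator_of_notMem hx]
      exact mul_nonneg ((hf.nonneg _).trans (hmf x)) χ.nonneg
  have heq : ∫ x, ⟪V x, gradient φ x⟫ = c * ((∫ x, m x * φ x) - r ^ d * I) := by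
    rw [hw φ hφs hφc htsU, ← hI', ← integral_sub hmφ hφi, ← integral_const_mul]
    congr 1
    funext x
    ring
  have hκ := sphArea_pos hd
  have hP : 0 < r ^ (d - 1) := by positivity
  have hfin : sphArea d * radMass d (profile e f) r ≤ r ^ (d - 1) * (ε * M / c + r * I) := by
    have h1 : (∫ x, m x * φ x) - r ^ d * I ≤ ε * (r ^ (d - 1) * M) / c := by
      rw [le_div_iff₀ hc, mul_comm, ← heq]
      exact hupper
    have h2 : r ^ d = r ^ (d - 1) * r := by rw [← hpow]; field_simp
    rw [h2] at h1
    calc _ ≤ _ := hlow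
      _ ≤ ε * (r ^ (d - 1) * M) / c + r ^ (d - 1) * r * I := by linarith
      _ = _ := by ring
  rw [radKer, abs_of_pos hr0, div_le_iff₀ hP, mul_assoc, le_inv_mul_iff₀ hκ, mul_comm _ (r ^ (d - 1))]
  exact hfin

/-- If a continuous field has a divergence dominating a radial density around `p`, then the radial
field generated by this density is continuous at the origin. -/
lemma tendsto_radKer_of_weak {d : ℕ} (hd : 1 ≤ d) {f : Euc d → ℝ} {a : ℝ}
    (hf : IsRadDensity f a) {e : Euc d} (he : ‖e‖ = 1) {U : Set (Euc d)} (hU : IsOpen U)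
    {p : Euc d} (hp : p ∈ U) {V : Euc d → Euc d} (hV : ContinuousOn V U) {c : ℝ} (hc : 0 < c)
    {m : Euc d → ℝ} (hm : LocallyIntegrable m) (hmf : ∀ x, f (x - p) ≤ m x)
    (hw : ∀ φ : Euc d → ℝ, ContDiff ℝ (⊤ : ℕ∞) φ → HasCompactSupport φ → tsupport φ ⊆ U →
      ∫ x, ⟪V x, gradient φ x⟫ = ∫ x, c * (m x - 1) * φ x) :
    Tendsto (radKer d (profile e f)) (𝓝[>] 0) (𝓝 0) := by
  obtain ⟨M, I, hM0, hI0, key⟩ := exists_radKer_le_of_weak hd hf he hU hp hV hc hm hmf hw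
  have hκ := sphArea_pos hd
  rw [Metric.tendsto_nhds]
  intro ε hε
  have h1 := key (ε * sphArea d * c / (2 * (M + 1))) (by positivity)
  have h2 : ∀ᶠ r in 𝓝[>] (0 : ℝ), r < ε * sphArea d / (2 * (I + 1)) :=
    mem_of_superset (Ioo_mem_nhdsGT (by positivity)) fun r hr => hr.2
  filter_upwards [h1, h2, self_mem_nhdsWithin] with r h1 h2 hr
  have hr : 0 < r := hr
  have hnn : 0 ≤ radKer d (profile e f) r :=
    div_nonneg (radMass_nonneg (fun _ => hf.nonneg _) r) (by positivity)
  rw [dist_zero_right, Real.norm_of_nonneg hnn]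
  refine h1.trans_lt ?_
  rw [inv_mul_lt_iff₀ hκ]
  have h3 : ε * sphArea d * c / (2 * (M + 1)) * M / c ≤ ε * sphArea d / 2 := by
    have : M / (M + 1) ≤ 1 := div_le_one_of_le₀ (by linarith) (by positivity)
    calc _ = ε * sphArea d / 2 * (M / (M + 1)) := by field_simp
      _ ≤ _ := mul_le_of_le_one_right (by positivity) this
  have h4 : r * I < ε * sphArea d / 2 := by
    rw [lt_div_iff₀ (by positivity)] at h2
    nlinarith
  linarith

lemma IsKer.exists_bound {d : ℕ} {A a : ℝ} {k : ℝ → ℝ} (hk : IsKer d A a k) (hA : 0 ≤ A) :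
    ∃ B : ℝ, 0 ≤ B ∧ ∀ r, 0 ≤ r → k r ≤ B := by
  obtain ⟨B, hB⟩ := (isCompact_Icc (a := (0 : ℝ)) (b := 1)).bddAbove_image hk.cont.continuousOn
  refine ⟨max A B, hA.trans (le_max_left _ _), fun r hr => ?_⟩
  rcases le_or_gt r 1 with h | h
  · exact (hB ⟨r, ⟨hr, h⟩, rfl⟩).trans (le_max_right _ _)
  · refine ((hk.le r (by linarith)).trans ?_).trans (le_max_left _ _)
    exact div_le_self hA (one_le_pow₀ h.le)

lemma IsKer.norm_radField_le {d : ℕ} {A a B : ℝ} {k : ℝ → ℝ} (hk : IsKer d A a k)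
    (hB : ∀ r, 0 ≤ r → k r ≤ B) (x : Euc d) : ‖radField k x‖ ≤ B := by
  refine (_root_.norm_radField_le k x).trans ?_
  rw [abs_of_nonneg (hk.nonneg _ (norm_nonneg x))]
  exact hB _ (norm_nonneg x)

lemma IsKer.continuous_radField {d : ℕ} {A a : ℝ} {k : ℝ → ℝ} (hk : IsKer d A a k) :
    Continuous (radField k : Euc d → Euc d) :=
  _root_.continuous_radField hk.cont hk.zero

lemma IsKer.mono {d : ℕ} {A a b : ℝ} {k : ℝ → ℝ} (hk : IsKer d A a k) (hab : a ≤ b) :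
    IsKer d A b k :=
  ⟨hk.cont, hk.zero, hk.nonneg, hk.le, fun r hr => hk.eq r (hab.trans hr)⟩

lemma _root_.HasGradientAt.comp_sub_const {d : ℕ} {u : Euc d → ℝ} {G x q : Euc d}
    (h : HasGradientAt u G (x - q)) : HasGradientAt (fun y => u (y - q)) G x := by
  rw [hasGradientAt_iff_hasFDerivAt]
  exact h.hasFDerivAt.comp x ((hasFDerivAt_id x).sub_const q)

/-- The average of the translates of a radial field over the ball of radius `1/2`. -/
def avgField {d : ℕ} (k : ℝ → ℝ) (x : Euc d) : Euc d := ∫ q, radField k (x - q) ∂ballProb d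

/-- The average of the translates of a radial potential over the ball of radius `1/2`. -/
def avgPot {d : ℕ} (k : ℝ → ℝ) (x : Euc d) : ℝ := ∫ q, radPot k (x - q) ∂ballProb d

section avg

variable {d : ℕ} {A a : ℝ} {k : ℝ → ℝ}

lemma IsKer.integrable_radField_sub (hk : IsKer d A a k) (hA : 0 ≤ A) (x : Euc d) :
    Integrable (fun q => radField k (x - q)) (ballProb d) := by
  obtain ⟨B, -, hB⟩ := hk.exists_bound hA
  exact Integrable.of_bound (hk.continuous_radField.comp
    (continuous_const.sub continuous_id)).aestronglyMeasurable B
    (.of_forall fun q => hk.norm_radField_le hB _)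

lemma continuous_avgField (hk : IsKer d A a k) (hA : 0 ≤ A) :
    Continuous (avgField k : Euc d → Euc d) := by
  obtain ⟨B, -, hB⟩ := hk.exists_bound hA
  refine continuous_of_dominated (bound := fun _ => B) (fun x => ?_) (fun x => ?_)
    (integrable_const B) (.of_forall fun q => ?_)
  · exact (hk.continuous_radField.comp (continuous_const.sub continuous_id)).aestronglyMeasurable
  · exact .of_forall fun q => hk.norm_radField_le hB _
  · exact hk.continuous_radField.comp (continuous_id.sub continuous_const)

lemma norm_avgField_le (hk : IsKer d A a k) {B : ℝ} (hB : ∀ r, 0 ≤ r → k r ≤ B) (x : Euc d) :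
    ‖avgField k x‖ ≤ B := by
  have := norm_integral_le_of_norm_le_const (μ := ballProb d)
    (.of_forall fun q => hk.norm_radField_le hB (x - q))
  simpa [avgField] using this

lemma hasGradientAt_avgPot (hk : IsKer d A a k) (hA : 0 ≤ A) (x : Euc d) :
    HasGradientAt (avgPot k) (avgField k x) x := by
  obtain ⟨B, hB0, hB⟩ := hk.exists_bound hA
  have hPc : Continuous (radPot k : Euc d → ℝ) := (contDiff_radPot hk.cont hk.zero).continuous
  have hint : Integrable (fun q => radPot k (x - q)) (ballProb d) := by
    have hb : ∃ M, ∀ q ∈ closedBall (0 : Euc d) (1 / 2), ‖radPot k (x - q)‖ ≤ M :=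
      (isCompact_closedBall _ _).exists_bound_of_continuousOn
        (hPc.comp (continuous_const.sub continuous_id)).continuousOn
    obtain ⟨M, hM⟩ := hb
    refine Integrable.of_bound
      (hPc.comp (continuous_const.sub continuous_id)).aestronglyMeasurable M ?_
    filter_upwards [ae_ballProb d] with q hq
    exact hM q (by simpa using hq)
  have h := hasFDerivAt_integral_of_dominated_of_fderiv_le (𝕜 := ℝ) (μ := ballProb d)
    (F := fun x q => radPot k (x - q)) (s := Set.univ) (bound := fun _ => B)
    (F' := fun x q => InnerProductSpace.toDual ℝ (Euc d) (radField k (x - q)))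
    (x₀ := x) univ_mem
    (.of_forall fun y => (hPc.comp (continuous_const.sub continuous_id)).aestronglyMeasurable)
    hint
    ((LinearIsometryEquiv.continuous _).comp
      (hk.continuous_radField.comp (continuous_const.sub continuous_id))).aestronglyMeasurable
    (.of_forall fun q y _ => by
      rw [LinearIsometryEquiv.norm_map]
      exact hk.norm_radField_le hB _)
    (integrable_const B)
    (.of_forall fun q y _ =>
      (hasGradientAt_radPot hk.cont hk.zero (y - q)).comp_sub_const.hasFDerivAt)
  rw [hasGradientAt_iff_hasFDerivAt]
  refine h.congr_fderiv (ContinuousLinearMap.ext fun v => ?_)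
  rw [ContinuousLinearMap.integral_apply]
  · simp only [InnerProductSpace.toDual_apply_apply]
    rw [avgField, ← real_inner_comm, ← integral_inner (hk.integrable_radField_sub hA x)]
    simp_rw [real_inner_comm v]
  · exact (InnerProductSpace.toDual ℝ (Euc d)).toLinearIsometry.toContinuousLinearMap.integrable_comp
      (hk.integrable_radField_sub hA x)

lemma integral_inner_avgField_sub {f : Euc d → ℝ} {e : Euc d} (hf : IsRadDensity f a)
    (he : ‖e‖ = 1) (hd : 1 ≤ d) {b : ℝ} (hA : 0 ≤ A) (hk : IsKer d A b (radKer d (profile e f)))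
    {φ : Euc d → ℝ} (hφ : ContDiff ℝ 1 φ) (hc : HasCompactSupport φ) (p : Euc d) :
    ∫ x, ⟪avgField (radKer d (profile e f)) (x - p), gradient φ x⟫ =
      - ∫ x, ballAvg f (x - p) * φ x := by
  set k := radKer d (profile e f)
  obtain ⟨B, hB0, hB⟩ := hk.exists_bound hA
  have hgc := continuous_gradient hφ
  have hgi : Integrable (gradient φ) := by
    refine hgc.integrable_of_hasCompactSupport ?_
    refine HasCompactSupport.of_support_subset_isCompact hc.isCompact fun x hx => ?_
    by_contra h
    exact hx (gradient_eq_zero_of_notMem_tsupport h)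
  have hint : Integrable (fun z : Euc d × Euc d => ⟪radField k (z.1 - p - z.2), gradient φ z.1⟫)
      (volume.prod (ballProb d)) := by
    have h1 : Integrable (fun z : Euc d × Euc d => B * ‖gradient φ z.1‖)
        (volume.prod (ballProb d)) := (hgi.norm.const_mul B).comp_fst _
    refine h1.mono' ?_ (.of_forall fun z => ?_)
    · have : Continuous fun z : Euc d × Euc d => ⟪radField k (z.1 - p - z.2), gradient φ z.1⟫ :=
        (hk.continuous_radField.comp (by fun_prop)).inner (hgc.comp continuous_fst)
      exact this.aestronglyMeasurable
    · exact (norm_inner_le_norm _ _).trans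
        (mul_le_mul_of_nonneg_right (hk.norm_radField_le hB _) (norm_nonneg _))
  obtain ⟨C, hC⟩ := hφ.continuous.bounded_above_of_compact_support hc
  have h1 : ∀ x, ⟪avgField k (x - p), gradient φ x⟫ =
      ∫ q, ⟪radField k (x - p - q), gradient φ x⟫ ∂ballProb d := by
    intro x
    rw [avgField, real_inner_comm, ← integral_inner (hk.integrable_radField_sub hA _)]
    simp_rw [real_inner_comm (gradient φ x)]
  simp_rw [h1]
  rw [integral_integral_swap hint]
  have h2 : ∀ q, ∫ x, ⟪radField k (x - p - q), gradient φ x⟫ =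
      - ∫ x, f (x - q) * φ (x + p) := by
    intro q
    simp_rw [sub_sub]
    rw [hf.integral_inner_radField_sub he hd hφ hc,
      ← integral_sub_right_eq_self (fun x => f (x - q) * φ (x + p)) p]
    simp [sub_sub]
  simp_rw [h2]
  rw [integral_neg, ← hf.integral_ballAvg_mul (φ := fun x => φ (x + p))
    (hφ.continuous.measurable.comp (measurable_add_const p)) (fun x => hC _),
    ← integral_sub_right_eq_self (fun x => ballAvg f x * φ (x + p)) p]
  simp

end avg

/-- Averaging over random perturbations of mean zero increases the energy of a field by at most
the fluctuation of the perturbations around any deterministic field. -/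
lemma exists_integral_norm_sub_le {X Q E : Type*} [MeasurableSpace X] [MeasurableSpace Q]
    [NormedAddCommGroup E] [InnerProductSpace ℝ E] [CompleteSpace E]
    {μ : Measure X} [IsFiniteMeasure μ] {P : Measure Q} [IsProbabilityMeasure P]
    {Z : X × Q → E} (hZ : AEStronglyMeasurable Z (μ.prod P)) {B : ℝ} (hZB : ∀ z, ‖Z z‖ ≤ B)
    (hZq : ∀ x, Integrable (fun q => Z (x, q)) P)
    (hZx : ∀ q, AEStronglyMeasurable (fun x => Z (x, q)) μ)
    {G : X → E} (hG : MemLp G 2 μ) {y : X → E} (hy : AEStronglyMeasurable y μ)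
    (hyB : ∀ x, ‖y x‖ ≤ B) (c : ℝ) {S : Set Q} (hS : P S = 0) :
    ∃ q ∉ S, ∫ x, ‖G x - c • (Z (x, q) - ∫ q', Z (x, q') ∂P)‖ ^ 2 ∂μ ≤
      ∫ x, ‖G x‖ ^ 2 ∂μ + c ^ 2 * ∫ x, ‖Z (x, q) - y x‖ ^ 2 ∂μ := by
  set W : X → E := fun x => ∫ q, Z (x, q) ∂P with hW
  have hWm : AEStronglyMeasurable W μ := hZ.integral_prod_right'
  have hWB : ∀ x, ‖W x‖ ≤ B := fun x => by
    have := norm_integral_le_of_norm_le_const (μ := P) (.of_forall fun q => hZB (x, q))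
    simpa using this
  have hWl : MemLp W 2 μ := MemLp.of_bound hWm B (.of_forall hWB)
  have hyl : MemLp y 2 μ := MemLp.of_bound hy B (.of_forall hyB)
  have hZl : ∀ q, MemLp (fun x => Z (x, q)) 2 μ := fun q =>
    MemLp.of_bound (hZx q) B (.of_forall fun x => hZB _)
  have hsq : ∀ {u : X → E}, MemLp u 2 μ → Integrable (fun x => ‖u x‖ ^ 2) μ := fun hu =>
    hu.integrable_norm_pow two_ne_zero
  have hGi : Integrable G μ := hG.integrable (by norm_num)
  let Φ : X × Q → ℝ := fun z => ‖G z.1‖ ^ 2 - 2 * c * ⟪G z.1, Z z - W z.1⟫ +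
    c ^ 2 * (‖W z.1‖ ^ 2 - ‖y z.1‖ ^ 2 - 2 * ⟪Z z, W z.1 - y z.1⟫)
  have hΦeq : ∀ x q, Φ (x, q) = ‖G x - c • (Z (x, q) - W x)‖ ^ 2 -
      c ^ 2 * ‖Z (x, q) - y x‖ ^ 2 := by
    intro x q
    simp only [Φ]
    rw [norm_sub_sq_real, norm_smul, mul_pow, norm_sub_sq_real (Z (x, q)) (W x),
      norm_sub_sq_real (Z (x, q)) (y x), inner_smul_right, inner_sub_right (Z (x, q)),
      Real.norm_eq_abs, sq_abs]
    ring
  have hΦi : Integrable Φ (μ.prod P) := by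
    have i1 : Integrable (fun z : X × Q => ‖G z.1‖ ^ 2) (μ.prod P) := (hsq hG).comp_fst P
    have mG : AEStronglyMeasurable (fun z : X × Q => G z.1) (μ.prod P) := hG.1.comp_fst
    have mW : AEStronglyMeasurable (fun z : X × Q => W z.1) (μ.prod P) := hWm.comp_fst
    have my : AEStronglyMeasurable (fun z : X × Q => y z.1) (μ.prod P) := hy.comp_fst
    have i2 : Integrable (fun z : X × Q => ⟪G z.1, Z z - W z.1⟫) (μ.prod P) := by
      have : Integrable (fun z : X × Q => (B + B) * ‖G z.1‖) (μ.prod P) :=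
        (hGi.norm.const_mul _).comp_fst P
      refine this.mono' (mG.inner (hZ.sub mW)) (.of_forall fun z => ?_)
      refine (norm_inner_le_norm _ _).trans ?_
      rw [mul_comm]
      exact mul_le_mul_of_nonneg_right ((norm_sub_le _ _).trans (add_le_add (hZB _) (hWB _)))
        (norm_nonneg _)
    have i3 : Integrable (fun z : X × Q => ‖W z.1‖ ^ 2 - ‖y z.1‖ ^ 2) (μ.prod P) :=
      ((hsq hWl).comp_fst P).sub ((hsq hyl).comp_fst P)
    have i4 : Integrable (fun z : X × Q => ⟪Z z, W z.1 - y z.1⟫) (μ.prod P) := by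
      refine Integrable.of_bound (hZ.inner (mW.sub my)) (B * (B + B)) (.of_forall fun z => ?_)
      refine (norm_inner_le_norm _ _).trans ?_
      exact mul_le_mul (hZB _) ((norm_sub_le _ _).trans (add_le_add (hWB _) (hyB _)))
        (norm_nonneg _) ((norm_nonneg _).trans (hZB z))
    exact (i1.sub (i2.const_mul _)).add ((i3.sub (i4.const_mul 2)).const_mul _)
  have hΦx : ∀ x, ∫ q, Φ (x, q) ∂P = ‖G x‖ ^ 2 - c ^ 2 * ‖W x - y x‖ ^ 2 := by
    intro x
    have j1 : Integrable (fun q => ⟪G x, Z (x, q) - W x⟫) P :=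
      ((hZq x).sub (integrable_const _)).const_inner _
    have j2 : Integrable (fun q => ⟪Z (x, q), W x - y x⟫) P := (hZq x).inner_const _
    have j0 : Integrable (fun q => Z (x, q) - W x) P := (hZq x).sub (integrable_const _)
    have v1 : ∫ q, ⟪G x, Z (x, q) - W x⟫ ∂P = 0 := by
      rw [integral_inner j0, integral_sub (hZq x) (integrable_const _)]
      simp [hW]
    have v2 : ∫ q, ⟪Z (x, q), W x - y x⟫ ∂P = ⟪W x, W x - y x⟫ := by
      simp_rw [real_inner_comm (W x - y x)]
      rw [integral_inner (hZq x)]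
    have j3 : Integrable (fun q => ‖G x‖ ^ 2 - 2 * c * ⟪G x, Z (x, q) - W x⟫) P :=
      (integrable_const _).sub (j1.const_mul _)
    have j4 : Integrable (fun q => ‖W x‖ ^ 2 - ‖y x‖ ^ 2 - 2 * ⟪Z (x, q), W x - y x⟫) P :=
      (integrable_const _).sub (j2.const_mul _)
    simp only [Φ]
    rw [integral_add j3 (j4.const_mul _),
      integral_sub (integrable_const _) (j1.const_mul _), integral_const_mul, v1,
      integral_const_mul, integral_sub (integrable_const _) (j2.const_mul _), integral_const_mul,
      v2, norm_sub_sq_real, inner_sub_right, real_inner_self_eq_norm_sq]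
    simp
    ring
  obtain ⟨q, hq, hle⟩ := exists_notMem_null_le_integral hΦi.integral_prod_right hS
  refine ⟨q, hq, ?_⟩
  have hswap : ∫ q, ∫ x, Φ (x, q) ∂μ ∂P ≤ ∫ x, ‖G x‖ ^ 2 ∂μ := by
    rw [← integral_integral_swap (f := fun x q => Φ (x, q)) hΦi]
    simp_rw [hΦx]
    refine integral_mono ((hsq hG).sub ((hsq (hWl.sub hyl)).const_mul _)) (hsq hG) fun x => ?_
    have : 0 ≤ c ^ 2 * ‖W x - y x‖ ^ 2 := by positivity
    simpa using this
  have hfin := hle.trans hswap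
  simp_rw [hΦeq] at hfin
  have n1 : Integrable (fun x => ‖G x - c • (Z (x, q) - W x)‖ ^ 2) μ :=
    hsq (hG.sub (((hZl q).sub hWl).const_smul c))
  have n2 : Integrable (fun x => ‖Z (x, q) - y x‖ ^ 2) μ := hsq ((hZl q).sub hyl)
  rw [integral_sub n1 (n2.const_mul _), integral_const_mul] at hfin
  linarith

/-- A linear bound for the radial kernels of averaged densities. -/
def avgSlope (d : ℕ) : ℝ := (volume (closedBall (0 : Euc d) (1 / 2))).toReal⁻¹ / d

lemma avgSlope_nonneg (d : ℕ) : 0 ≤ avgSlope d := by unfold avgSlope; positivity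

namespace IsRadDensity

variable {d : ℕ} {f : Euc d → ℝ} {a : ℝ} {e : Euc d}

lemma isKer_ballAvg (hf : IsRadDensity f a) (he : ‖e‖ = 1) (hd : 1 ≤ d) (ha : 0 < a) :
    IsKer d (sphArea d)⁻¹ (a + 1 / 2) (radKer d (profile e (ballAvg f))) :=
  hf.ballAvg_isRadDensity.isKer he hd (by positivity)
    (hf.ballAvg_isRadDensity.tendsto_radKer he hd hf.ballAvg_le)

lemma radKer_ballAvg_le_mul (hf : IsRadDensity f a) (he : ‖e‖ = 1) (hd : 1 ≤ d) {r : ℝ}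
    (hr : 0 ≤ r) : radKer d (profile e (ballAvg f)) r ≤ avgSlope d * r :=
  hf.ballAvg_isRadDensity.radKer_le he hd hf.ballAvg_le hr

lemma radKer_ballAvg_le (hf : IsRadDensity f a) (he : ‖e‖ = 1) (hd : 1 ≤ d) (ha : 0 < a) {r : ℝ}
    (hr : 0 ≤ r) : radKer d (profile e (ballAvg f)) r ≤ avgSlope d + (sphArea d)⁻¹ := by
  have hA : 0 ≤ (sphArea d)⁻¹ := (inv_pos.2 (sphArea_pos hd)).le
  have hB := avgSlope_nonneg d
  rcases le_or_gt r 1 with h | h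
  · have h1 := hf.radKer_ballAvg_le_mul he hd hr
    nlinarith
  · have h1 := (hf.isKer_ballAvg he hd ha).le r (by linarith)
    have h2 : (sphArea d)⁻¹ / r ^ (d - 1) ≤ (sphArea d)⁻¹ := div_le_self hA (one_le_pow₀ h.le)
    linarith

/-- The potential difference between a density and its average over the ball of radius `1/2`. -/
def tailPot (e : Euc d) (f : Euc d → ℝ) : Euc d → ℝ :=
  diffPot (radKer d (profile e f)) (radKer d (profile e (ballAvg f)))

lemma tailPot_eq_zero (hf : IsRadDensity f a) (he : ‖e‖ = 1) (hd : 1 ≤ d) (ha : 0 < a)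
    (ha4 : a ≤ 1 / 4) (hk : IsKer d (sphArea d)⁻¹ a (radKer d (profile e f))) {x : Euc d}
    (hx : 3 / 4 ≤ ‖x‖) : tailPot e f x = 0 :=
  diffPot_eq_zero hk (hf.isKer_ballAvg he hd ha) (by norm_num) (by linarith) (by linarith) hx

lemma tsupport_tailPot_sub (hf : IsRadDensity f a) (he : ‖e‖ = 1) (hd : 1 ≤ d) (ha : 0 < a)
    (ha4 : a ≤ 1 / 4) (hk : IsKer d (sphArea d)⁻¹ a (radKer d (profile e f))) (p : Euc d) :
    tsupport (fun x => tailPot e f (x - p)) ⊆ closedBall p (3 / 4) := by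
  refine closure_minimal (fun x hx => ?_) isClosed_closedBall
  by_contra h
  rw [mem_closedBall, dist_eq_norm, not_le] at h
  exact hx (hf.tailPot_eq_zero he hd ha ha4 hk h.le)

lemma hasCompactSupport_tailPot_sub (hf : IsRadDensity f a) (he : ‖e‖ = 1) (hd : 1 ≤ d)
    (ha : 0 < a) (ha4 : a ≤ 1 / 4) (hk : IsKer d (sphArea d)⁻¹ a (radKer d (profile e f)))
    (p : Euc d) : HasCompactSupport (fun x => tailPot e f (x - p)) :=
  HasCompactSupport.of_support_subset_isCompact (isCompact_closedBall p (3 / 4))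
    (subset_closure.trans (hf.tsupport_tailPot_sub he hd ha ha4 hk p))

lemma contDiff_tailPot (hf : IsRadDensity f a) (he : ‖e‖ = 1) (hd : 1 ≤ d) (ha : 0 < a)
    (hk : IsKer d (sphArea d)⁻¹ a (radKer d (profile e f))) : ContDiff ℝ 1 (tailPot e f) :=
  contDiff_diffPot hk (hf.isKer_ballAvg he hd ha)

lemma gradient_tailPot (hf : IsRadDensity f a) (he : ‖e‖ = 1) (hd : 1 ≤ d) (ha : 0 < a)
    (hk : IsKer d (sphArea d)⁻¹ a (radKer d (profile e f))) (x : Euc d) :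
    gradient (tailPot e f) x =
      radField (radKer d (profile e (ballAvg f))) x - radField (radKer d (profile e f)) x :=
  (hasGradientAt_diffPot hk (hf.isKer_ballAvg he hd ha) x).gradient

lemma integrable_mul_tailPot {g : Euc d → ℝ} (hg : Integrable g)
    (hf : IsRadDensity f a) (he : ‖e‖ = 1) (hd : 1 ≤ d) (ha : 0 < a) (ha4 : a ≤ 1 / 4)
    (hk : IsKer d (sphArea d)⁻¹ a (radKer d (profile e f))) (p : Euc d) :
    Integrable fun x => g x * tailPot e f (x - p) := by
  simpa [smul_eq_mul, mul_comm] using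
    hg.locallyIntegrable.integrable_smul_left_of_hasCompactSupport
      ((hf.contDiff_tailPot he hd ha hk).continuous.comp (continuous_id.sub continuous_const))
      (hf.hasCompactSupport_tailPot_sub he hd ha ha4 hk p)

lemma integral_norm_sub_sq (hf : IsRadDensity f a) (he : ‖e‖ = 1) (hd : 1 ≤ d) (ha : 0 < a)
    (ha4 : a ≤ 1 / 4) (hk : IsKer d (sphArea d)⁻¹ a (radKer d (profile e f))) :
    (Integrable fun x : Euc d => ‖radField (radKer d (profile e f)) x -
      radField (radKer d (profile e (ballAvg f))) x‖ ^ 2) ∧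
    ∫ x : Euc d, ‖radField (radKer d (profile e f)) x -
      radField (radKer d (profile e (ballAvg f))) x‖ ^ 2 =
      (∫ x, f x * tailPot e f x) - ∫ x, ballAvg f x * tailPot e f x := by
  have hl := hf.isKer_ballAvg he hd ha
  have ht := hf.contDiff_tailPot he hd ha hk
  have htc : HasCompactSupport (tailPot e f) := by
    simpa using hf.hasCompactSupport_tailPot_sub he hd ha ha4 hk 0
  have i1 := integrable_inner_gradient (U := Set.univ) hk.continuous_radField.continuousOn ht htc
    (Set.subset_univ _)
  have i2 := integrable_inner_gradient (U := Set.univ) hl.continuous_radField.continuousOn ht htc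
    (Set.subset_univ _)
  have h1 := hf.integral_inner_radField_sub he hd ht htc 0
  have h2 := hf.ballAvg_isRadDensity.integral_inner_radField_sub he hd ht htc 0
  simp only [sub_zero] at h1 h2
  have heq : (fun x : Euc d => ‖radField (radKer d (profile e f)) x -
      radField (radKer d (profile e (ballAvg f))) x‖ ^ 2) = fun x =>
      ⟪radField (radKer d (profile e (ballAvg f))) x, gradient (tailPot e f) x⟫ -
      ⟪radField (radKer d (profile e f)) x, gradient (tailPot e f) x⟫ := by
    funext x
    rw [← inner_sub_left, hf.gradient_tailPot he hd ha hk, real_inner_self_eq_norm_sq,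
      norm_sub_rev]
  rw [heq]
  refine ⟨i2.sub i1, ?_⟩
  rw [integral_sub i2 i1, h1, h2]
  ring

end IsRadDensity

open IsRadDensity

/-- Moving a smeared charge by at most `1/2` and comparing with its averaged field costs at most
the self energy plus a constant. -/
lemma exists_translate_energy_le (d : ℕ) (hd : 1 ≤ d) :
    ∃ C : ℝ, 0 ≤ C ∧ ∀ (f : Euc d → ℝ) (a : ℝ) (e : Euc d), IsRadDensity f a → ‖e‖ = 1 →
      0 < a → a ≤ 1 / 4 → IsKer d (sphArea d)⁻¹ a (radKer d (profile e f)) →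
      (∀ x, 0 ≤ tailPot e f x) → ∀ q : Euc d, ‖q‖ ≤ 1 / 2 →
        (Integrable fun x => ‖radField (radKer d (profile e f)) (x - q) -
          radField (radKer d (profile e (ballAvg f))) x‖ ^ 2) ∧
        ∫ x, ‖radField (radKer d (profile e f)) (x - q) -
          radField (radKer d (profile e (ballAvg f))) x‖ ^ 2 ≤ (∫ x, f x * tailPot e f x) + C := by
  have hA : 0 ≤ (sphArea d)⁻¹ := (inv_pos.2 (sphArea_pos hd)).le
  set A := (sphArea d)⁻¹ with hAdef
  obtain ⟨C₁, hC₁, hdip⟩ := exists_dipole_bound d hd (B := avgSlope d + A) hA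
  have hJ : Integrable fun x : Euc d => (((1 + ‖x‖) ^ d)⁻¹) ^ 2 := by
    have h := integrable_one_add_norm (E := Euc d) (μ := volume) (r := (2 * d : ℕ)) (by
      rw [finrank_euclideanSpace_fin]
      exact_mod_cast (by omega : d < 2 * d))
    convert h using 2 with x
    rw [Real.rpow_neg (by positivity), Real.rpow_natCast, inv_pow, ← pow_mul, mul_comm 2 d]
  refine ⟨2 * C₁ * A * (∫ x, truncRiesz d x) + C₁ ^ 2 * ∫ x : Euc d, (((1 + ‖x‖) ^ d)⁻¹) ^ 2, ?_,
    ?_⟩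
  · have h1 : 0 ≤ ∫ x, truncRiesz d x := integral_nonneg truncRiesz_nonneg
    have h2 : 0 ≤ ∫ x : Euc d, (((1 + ‖x‖) ^ d)⁻¹) ^ 2 := integral_nonneg fun _ => by positivity
    positivity
  intro f a e hf he ha ha4 hk ht q hq
  have hl := hf.isKer_ballAvg he hd ha
  have hdip' := hdip _ (hl.mono (by linarith)) (fun r hr => hf.radKer_ballAvg_le he hd ha hr) q hq
  obtain ⟨i0, e0⟩ := hf.integral_norm_sub_sq he hd ha ha4 hk
  set k := radKer d (profile e f)
  set l := radKer d (profile e (ballAvg f))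
  have hτ := fun x : Euc d => norm_radField_sub_le hk hl (by linarith) (by linarith) hA x
  have hpt : ∀ x : Euc d, ‖radField k (x - q) - radField l x‖ ^ 2 ≤
      ‖radField k (x - q) - radField l (x - q)‖ ^ 2 + 2 * C₁ * A * truncRiesz d (x - q) +
        C₁ ^ 2 * (((1 + ‖x‖) ^ d)⁻¹) ^ 2 := by
    intro x
    set u := ‖radField k (x - q) - radField l (x - q)‖
    set J := ((1 + ‖x‖) ^ d)⁻¹ with hJdef
    have hJ0 : 0 ≤ J := by positivity
    have hJ1 : J ≤ 1 := inv_le_one_of_one_le₀ (one_le_pow₀ (by linarith [norm_nonneg x]))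
    have hu0 : 0 ≤ u := norm_nonneg _
    have h1 : ‖radField k (x - q) - radField l x‖ ≤ u + C₁ * J := by
      have := norm_add_le (radField k (x - q) - radField l (x - q))
        (radField l (x - q) - radField l x)
      rw [sub_add_sub_cancel] at this
      linarith [hdip' x]
    have h2 : u * J ≤ A * truncRiesz d (x - q) :=
      (mul_le_of_le_one_right hu0 hJ1).trans (hτ _)
    calc _ ≤ (u + C₁ * J) ^ 2 := by gcongr
      _ = u ^ 2 + 2 * C₁ * (u * J) + C₁ ^ 2 * J ^ 2 := by ring
      _ ≤ u ^ 2 + 2 * C₁ * (A * truncRiesz d (x - q)) + C₁ ^ 2 * J ^ 2 := by gcongr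
      _ = _ := by ring
  have hR := integrable_truncRiesz hd
  have i1 : Integrable fun x : Euc d => ‖radField k (x - q) - radField l (x - q)‖ ^ 2 :=
    i0.comp_sub_right q
  have i2 : Integrable fun x : Euc d => 2 * C₁ * A * truncRiesz d (x - q) :=
    (hR.comp_sub_right q).const_mul _
  have i12 : Integrable fun x : Euc d => ‖radField k (x - q) - radField l (x - q)‖ ^ 2 +
    2 * C₁ * A * truncRiesz d (x - q) := i1.add i2
  have i3 : Integrable fun x : Euc d => C₁ ^ 2 * (((1 + ‖x‖) ^ d)⁻¹) ^ 2 := hJ.const_mul _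
  have iY : Integrable fun x : Euc d => ‖radField k (x - q) - radField l x‖ ^ 2 := by
    refine (i12.add i3).mono' ?_ (.of_forall fun x => ?_)
    · exact (((hk.continuous_radField.comp (continuous_id.sub continuous_const)).sub
        hl.continuous_radField).norm.pow 2).aestronglyMeasurable
    · rw [Real.norm_of_nonneg (by positivity)]
      exact hpt x
  refine ⟨iY, (integral_mono iY (i12.add i3) hpt).trans ?_⟩
  have hF : 0 ≤ ∫ x, ballAvg f x * tailPot e f x :=
    integral_nonneg fun x => mul_nonneg (hf.ballAvg_isRadDensity.nonneg x) (ht x)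
  have s1 := integral_sub_right_eq_self
    (fun x : Euc d => ‖radField k x - radField l x‖ ^ 2) q (μ := volume)
  have s2 := integral_sub_right_eq_self (truncRiesz d) q (μ := volume)
  simp only [Pi.add_apply]
  rw [integral_add i12 i3, integral_add i1 i2, integral_const_mul, integral_const_mul, s1, s2, e0]
  linarith

lemma gradient_comp_sub {d : ℕ} (u : Euc d → ℝ) (p x : Euc d) :
    gradient (fun y => u (y - p)) x = gradient u (x - p) := by
  unfold gradient
  simp only [sub_eq_add_neg]
  rw [fderiv_comp_add_right]

lemma integrable_inner_gradient_of_continuous {d : ℕ} {V : Euc d → Euc d} (hV : Continuous V)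
    {φ : Euc d → ℝ} (hφ : ContDiff ℝ 1 φ) (hc : HasCompactSupport φ) :
    Integrable fun x => ⟪V x, gradient φ x⟫ :=
  integrable_inner_gradient (U := Set.univ) hV.continuousOn hφ hc (Set.subset_univ _)

/-- Potential whose addition moves a smeared charge from `p` to `p + q`. -/
def movePot {d : ℕ} (e : Euc d) (f : Euc d → ℝ) (c : ℝ) (p q x : Euc d) : ℝ :=
  - c * (radPot (radKer d (profile e f)) (x - (p + q)) - avgPot (radKer d (profile e f)) (x - p))
    - c * tailPot e f (x - p)

section move

variable {d : ℕ} {f : Euc d → ℝ} {a : ℝ} {e : Euc d}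

lemma hasGradientAt_movePot (hf : IsRadDensity f a) (he : ‖e‖ = 1) (hd : 1 ≤ d) (ha : 0 < a)
    (hk : IsKer d (sphArea d)⁻¹ a (radKer d (profile e f))) (c : ℝ) (p q x : Euc d) :
    HasGradientAt (movePot e f c p q)
      (-(c • gradient (tailPot e f) (x - p)) - c • (radField (radKer d (profile e f)) (x - p - q) -
        avgField (radKer d (profile e f)) (x - p))) x := by
  have hA : 0 ≤ (sphArea d)⁻¹ := (inv_pos.2 (sphArea_pos hd)).le
  have h1 := (hasGradientAt_radPot hk.cont hk.zero (x - (p + q))).comp_sub_const.hasFDerivAt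
  have h2 := (hasGradientAt_avgPot hk hA (x - p)).comp_sub_const.hasFDerivAt
  have h3 := (hasGradientAt_diffPot hk (hf.isKer_ballAvg he hd ha)
    (x - p)).comp_sub_const.hasFDerivAt
  rw [hasGradientAt_iff_hasFDerivAt]
  refine (((h1.sub h2).const_mul (-c)).sub (h3.const_mul c)).congr_fderiv ?_
  rw [hf.gradient_tailPot he hd ha hk]
  ext v
  simp only [map_sub, map_neg, map_smul, sub_sub, sub_apply,
    smul_apply, neg_apply, smul_eq_mul]
  ring

lemma gradient_movePot (hf : IsRadDensity f a) (he : ‖e‖ = 1) (hd : 1 ≤ d) (ha : 0 < a)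
    (hk : IsKer d (sphArea d)⁻¹ a (radKer d (profile e f))) (c : ℝ) (p q x : Euc d) :
    gradient (movePot e f c p q) x =
      -(c • gradient (tailPot e f) (x - p)) - c • (radField (radKer d (profile e f)) (x - p - q) -
        avgField (radKer d (profile e f)) (x - p)) :=
  (hasGradientAt_movePot hf he hd ha hk c p q x).gradient

lemma contDiff_movePot (hf : IsRadDensity f a) (he : ‖e‖ = 1) (hd : 1 ≤ d) (ha : 0 < a)
    (hk : IsKer d (sphArea d)⁻¹ a (radKer d (profile e f))) (c : ℝ) (p q : Euc d) :
    ContDiff ℝ 1 (movePot e f c p q) := by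
  have hA : 0 ≤ (sphArea d)⁻¹ := (inv_pos.2 (sphArea_pos hd)).le
  refine contDiff_one_of_hasGradientAt (hasGradientAt_movePot hf he hd ha hk c p q) ?_
  have h1 := continuous_gradient (hf.contDiff_tailPot he hd ha hk)
  have h2 := hk.continuous_radField (d := d)
  have h3 := continuous_avgField hk hA
  fun_prop

lemma exists_norm_gradient_movePot_le (hf : IsRadDensity f a) (he : ‖e‖ = 1) (hd : 1 ≤ d)
    (ha : 0 < a) (hk : IsKer d (sphArea d)⁻¹ a (radKer d (profile e f))) (c : ℝ) (p q : Euc d) :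
    ∃ M, ∀ x, ‖gradient (movePot e f c p q) x‖ ≤ M := by
  have hA : 0 ≤ (sphArea d)⁻¹ := (inv_pos.2 (sphArea_pos hd)).le
  obtain ⟨B, -, hB⟩ := hk.exists_bound hA
  obtain ⟨B', -, hB'⟩ := (hf.isKer_ballAvg he hd ha).exists_bound hA
  refine ⟨|c| * (B' + B) + |c| * (B + B), fun x => ?_⟩
  rw [gradient_movePot hf he hd ha hk, hf.gradient_tailPot he hd ha hk]
  refine (norm_sub_le _ _).trans ?_
  rw [norm_neg, norm_smul, norm_smul, Real.norm_eq_abs]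
  gcongr
  · exact (norm_sub_le _ _).trans (add_le_add ((hf.isKer_ballAvg he hd ha).norm_radField_le hB' _)
      (hk.norm_radField_le hB _))
  · exact (norm_sub_le _ _).trans (add_le_add (hk.norm_radField_le hB _)
      (norm_avgField_le hk hB _))

lemma integral_inner_gradient_movePot (hf : IsRadDensity f a) (he : ‖e‖ = 1) (hd : 1 ≤ d)
    (ha : 0 < a) (hk : IsKer d (sphArea d)⁻¹ a (radKer d (profile e f))) (c : ℝ) (p q : Euc d)
    {φ : Euc d → ℝ} (hφ : ContDiff ℝ 1 φ) (hc : HasCompactSupport φ) :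
    ∫ x, ⟪gradient (movePot e f c p q) x, gradient φ x⟫ =
      c * ((∫ x, f (x - (p + q)) * φ x) - ∫ x, f (x - p) * φ x) := by
  have hA : 0 ≤ (sphArea d)⁻¹ := (inv_pos.2 (sphArea_pos hd)).le
  have hl := hf.isKer_ballAvg he hd ha
  have e1 := hf.integral_inner_radField_sub he hd hφ hc (p + q)
  have e2 := integral_inner_avgField_sub hf he hd hA hk hφ hc p
  have e3 := hf.ballAvg_isRadDensity.integral_inner_radField_sub he hd hφ hc p
  have e4 := hf.integral_inner_radField_sub he hd hφ hc p
  have i1 : Integrable fun x =>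
      ⟪radField (radKer d (profile e f)) (x - (p + q)), gradient φ x⟫ :=
    integrable_inner_gradient_of_continuous (hk.continuous_radField.comp
      (continuous_id.sub (continuous_const (y := p + q)))) hφ hc
  have i2 : Integrable fun x => ⟪avgField (radKer d (profile e f)) (x - p), gradient φ x⟫ :=
    integrable_inner_gradient_of_continuous ((continuous_avgField hk hA).comp
      (continuous_id.sub (continuous_const (y := p)))) hφ hc
  have i3 : Integrable fun x =>
      ⟪radField (radKer d (profile e (ballAvg f))) (x - p), gradient φ x⟫ :=
    integrable_inner_gradient_of_continuous (hl.continuous_radField.comp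
      (continuous_id.sub (continuous_const (y := p)))) hφ hc
  have i4 : Integrable fun x => ⟪radField (radKer d (profile e f)) (x - p), gradient φ x⟫ :=
    integrable_inner_gradient_of_continuous (hk.continuous_radField.comp
      (continuous_id.sub (continuous_const (y := p)))) hφ hc
  simp_rw [gradient_movePot hf he hd ha hk, hf.gradient_tailPot he hd ha hk, inner_sub_left,
    inner_neg_left, real_inner_smul_left, inner_sub_left, sub_sub]
  have i34 : Integrable fun x =>
      -(c * (⟪radField (radKer d (profile e (ballAvg f))) (x - p), gradient φ x⟫ -
        ⟪radField (radKer d (profile e f)) (x - p), gradient φ x⟫)) :=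
    ((i3.sub i4).const_mul c).neg
  have i12 : Integrable fun x =>
      c * (⟪radField (radKer d (profile e f)) (x - (p + q)), gradient φ x⟫ -
        ⟪avgField (radKer d (profile e f)) (x - p), gradient φ x⟫) :=
    (i1.sub i2).const_mul c
  rw [integral_sub i34 i12, integral_neg, integral_const_mul, integral_const_mul,
    integral_sub i3 i4, integral_sub i1 i2, e1, e2, e3, e4]
  ring

/-- The energy of a field after moving a charge of its divergence to a well chosen place. -/
lemma exists_move_energy_le (d : ℕ) (hd : 1 ≤ d) :
    ∃ C : ℝ, 0 ≤ C ∧ ∀ (f : Euc d → ℝ) (a : ℝ) (e : Euc d), IsRadDensity f a → ‖e‖ = 1 →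
      0 < a → a ≤ 1 / 4 → IsKer d (sphArea d)⁻¹ a (radKer d (profile e f)) →
      (∀ x, 0 ≤ tailPot e f x) → ∀ (c : ℝ) (K : Set (Euc d)), IsCompact K →
      ∀ V : Euc d → Euc d, MemLp V 2 (volume.restrict K) →
      ∀ p : Euc d, closedBall p (3 / 4) ⊆ K → ∃ q : Euc d, ‖q‖ ≤ 1 / 2 ∧
        ∫ x in K, ‖V x + gradient (movePot e f c p q) x‖ ^ 2 ≤ (∫ x in K, ‖V x‖ ^ 2) -
          2 * c * (∫ x, ⟪V x, gradient (fun y => tailPot e f (y - p)) x⟫) +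
          2 * c ^ 2 * (∫ x, f x * tailPot e f x) + c ^ 2 * C := by
  obtain ⟨C, hC, hCe⟩ := exists_translate_energy_le d hd
  refine ⟨C, hC, fun f a e hf he ha ha4 hk ht c K hK V hV p hp => ?_⟩
  have hA : 0 ≤ (sphArea d)⁻¹ := (inv_pos.2 (sphArea_pos hd)).le
  have hl := hf.isKer_ballAvg he hd ha
  have hmove := gradient_movePot hf he hd ha hk c p
  have htr := hCe f a e hf he ha ha4 hk ht
  have hts := hf.tsupport_tailPot_sub he hd ha ha4 hk p
  have htd := hf.contDiff_tailPot he hd ha hk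
  obtain ⟨i0, e0⟩ := hf.integral_norm_sub_sq he hd ha ha4 hk
  have hgt := hf.gradient_tailPot he hd ha hk
  obtain ⟨B, hB0, hB⟩ := hk.exists_bound hA
  obtain ⟨B', hB0', hB'⟩ := hl.exists_bound hA
  set k := radKer d (profile e f)
  set l := radKer d (profile e (ballAvg f))
  have : IsFiniteMeasure (volume.restrict K) := ⟨by
    rw [Measure.restrict_apply_univ]; exact hK.measure_lt_top⟩
  set D : Euc d → Euc d := fun x => gradient (tailPot e f) (x - p) with hD
  have hDc : Continuous D := (continuous_gradient htd).comp (continuous_id.sub continuous_const)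
  have hDl : MemLp D 2 (volume.restrict K) := by
    refine MemLp.of_bound hDc.aestronglyMeasurable (B' + B) (.of_forall fun x => ?_)
    simp only [hD, hgt]
    exact (norm_sub_le _ _).trans (add_le_add (hl.norm_radField_le hB' _)
      (hk.norm_radField_le hB _))
  have hZc : Continuous fun z : Euc d × Euc d => radField k (z.1 - p - z.2) :=
    hk.continuous_radField.comp (by fun_prop)
  obtain ⟨q, hq, hle⟩ := exists_integral_norm_sub_le (μ := volume.restrict K) (P := ballProb d)
    (Z := fun z : Euc d × Euc d => radField k (z.1 - p - z.2)) (B := max B B')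
    hZc.aestronglyMeasurable (fun z => (hk.norm_radField_le hB _).trans (le_max_left _ _))
    (fun x => hk.integrable_radField_sub hA (x - p))
    (fun q => (hZc.comp (by fun_prop : Continuous fun x : Euc d => (x, q))).aestronglyMeasurable)
    (G := fun x => V x - c • D x) (hV.sub (hDl.const_smul c)) (y := fun x => radField l (x - p))
    (hl.continuous_radField.comp (continuous_id.sub continuous_const)).aestronglyMeasurable
    (fun x => (hl.norm_radField_le hB' _).trans (le_max_right _ _)) c (ballProb_compl d)
  rw [Set.notMem_compl_iff, mem_closedBall_zero_iff] at hq
  refine ⟨q, hq, ?_⟩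
  have hL : ∀ x, ‖V x + gradient (movePot e f c p q) x‖ ^ 2 = ‖V x - c • D x - c •
      (radField k (x - p - q) - ∫ q', radField k (x - p - q') ∂ballProb d)‖ ^ 2 := by
    intro x
    rw [hmove q x]
    congr 2
    simp only [hD, avgField]
    abel
  simp_rw [hL]
  refine hle.trans ?_
  obtain ⟨iY, hY⟩ := htr q hq
  have hY2 : ∫ x in K, ‖radField k (x - p - q) - radField l (x - p)‖ ^ 2 ≤
      (∫ x, f x * tailPot e f x) + C := by
    refine le_trans ?_ hY
    rw [← integral_sub_right_eq_self
      (fun x : Euc d => ‖radField k (x - q) - radField l x‖ ^ 2) p (μ := volume)]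
    exact setIntegral_le_integral (iY.comp_sub_right p) (.of_forall fun x => by positivity)
  have hD2 : ∫ x in K, ‖D x‖ ^ 2 ≤ ∫ x, f x * tailPot e f x := by
    have hF : 0 ≤ ∫ x, ballAvg f x * tailPot e f x :=
      integral_nonneg fun x => mul_nonneg (hf.ballAvg_isRadDensity.nonneg x) (ht x)
    have h1 : ∀ x, ‖D x‖ ^ 2 = ‖radField k (x - p) - radField l (x - p)‖ ^ 2 := fun x => by
      simp only [hD, hgt]
      rw [norm_sub_rev]
    simp_rw [h1]
    have h2 := setIntegral_le_integral (s := K) (i0.comp_sub_right p)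
      (.of_forall fun x => by positivity)
    rw [integral_sub_right_eq_self
      (fun x : Euc d => ‖radField k x - radField l x‖ ^ 2) p (μ := volume), e0] at h2
    linarith
  have iVD : Integrable (fun x => ⟪V x, D x⟫) (volume.restrict K) := by
    refine ((hV.integrable one_le_two).norm.mul_const (B' + B)).mono'
      (hV.aestronglyMeasurable.inner hDc.aestronglyMeasurable) (.of_forall fun x => ?_)
    refine (norm_inner_le_norm _ _).trans (mul_le_mul_of_nonneg_left ?_ (norm_nonneg _))
    simp only [hD, hgt]
    exact (norm_sub_le _ _).trans (add_le_add (hl.norm_radField_le hB' _)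
      (hk.norm_radField_le hB _))
  have iV : Integrable (fun x => ‖V x‖ ^ 2) (volume.restrict K) :=
    hV.integrable_norm_pow two_ne_zero
  have iD : Integrable (fun x => ‖D x‖ ^ 2) (volume.restrict K) :=
    hDl.integrable_norm_pow two_ne_zero
  have hG : ∫ x in K, ‖V x - c • D x‖ ^ 2 = (∫ x in K, ‖V x‖ ^ 2) -
      2 * c * (∫ x, ⟪V x, gradient (fun y => tailPot e f (y - p)) x⟫) +
      c ^ 2 * ∫ x in K, ‖D x‖ ^ 2 := by
    have h1 : ∀ x, ‖V x - c • D x‖ ^ 2 = ‖V x‖ ^ 2 - 2 * c * ⟪V x, D x⟫ + c ^ 2 * ‖D x‖ ^ 2 := by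
      intro x
      rw [norm_sub_sq_real, norm_smul, mul_pow, inner_smul_right, Real.norm_eq_abs, sq_abs]
      ring
    have h2 : ∫ x, ⟪V x, gradient (fun y => tailPot e f (y - p)) x⟫ = ∫ x in K, ⟪V x, D x⟫ := by
      rw [setIntegral_eq_integral_of_forall_compl_eq_zero]
      · simp_rw [gradient_comp_sub]
        rfl
      · intro x hx
        have : gradient (fun y => tailPot e f (y - p)) x = 0 :=
          gradient_eq_zero_of_notMem_tsupport fun h => hx (hp (hts h))
        rw [gradient_comp_sub] at this
        simp [hD, this]
    simp_rw [h1]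
    have iVV : Integrable (fun x => ‖V x‖ ^ 2 - 2 * c * ⟪V x, D x⟫) (volume.restrict K) :=
      iV.sub (iVD.const_mul _)
    rw [integral_add iVV (iD.const_mul _), integral_sub iV (iVD.const_mul _), integral_const_mul,
      integral_const_mul, h2]
  rw [hG]
  have hc2 := sq_nonneg c
  have m1 := mul_le_mul_of_nonneg_left hY2 hc2
  have m2 := mul_le_mul_of_nonneg_left hD2 hc2
  linarith

end move

lemma exists_le_tailPot {d : ℕ} (hd : 2 ≤ d) {M : ℝ} (hM : 0 ≤ M) :
    ∃ r : ℝ, 0 < r ∧ r ≤ 1 / 2 ∧ ∀ (f : Euc d → ℝ) (a : ℝ) (e : Euc d), IsRadDensity f a →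
      ‖e‖ = 1 → 0 < a → a ≤ 1 / 4 → a ≤ r → IsKer d (sphArea d)⁻¹ a (radKer d (profile e f)) →
      (∀ x, ‖x‖ ≤ r → M ≤ tailPot e f x) ∧ ∀ x, 0 ≤ tailPot e f x := by
  have hd1 : 1 ≤ d := by omega
  have hA : 0 < (sphArea d)⁻¹ := inv_pos.2 (sphArea_pos hd1)
  have hB := avgSlope_nonneg d
  set A := (sphArea d)⁻¹
  set B := avgSlope d
  set r₀ := min (1 / 2) (A / (2 * (B + 1))) with hr₀
  have hr₀pos : 0 < r₀ := lt_min (by norm_num) (by positivity)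
  have hBr : B * r₀ ≤ A / 2 := by
    calc B * r₀ ≤ (B + 1) * (A / (2 * (B + 1))) :=
          mul_le_mul (by linarith) (min_le_right _ _) hr₀pos.le (by linarith)
      _ = A / 2 := by field_simp
  set s := 2 * (M + B) / A with hs
  have hs0 : 0 ≤ s := by positivity
  have hle : r₀ * exp (-s) ≤ r₀ :=
    mul_le_of_le_one_right hr₀pos.le (exp_le_one_iff.2 (by linarith))
  refine ⟨r₀ * exp (-s), by positivity, hle.trans (min_le_left _ _),
    fun f a e hf he ha ha4 har hk => ?_⟩
  have hl := hf.isKer_ballAvg he hd1 ha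
  have hnear : ∀ x, ‖x‖ ≤ r₀ * exp (-s) → M ≤ tailPot e f x := by
    intro x hx
    have h := le_diffPot hd hk hl hA.le hB (fun r hr => hf.radKer_ballAvg_le_mul he hd1 hr)
      ((min_le_left _ _).trans (by norm_num)) hBr ha har hle hx
    have hlog : log (r₀ / (r₀ * exp (-s))) = s := by
      rw [div_mul_cancel_left₀ hr₀pos.ne', exp_neg, inv_inv, log_exp]
    rw [hlog] at h
    have : A / 2 * s = M + B := by rw [hs]; field_simp
    exact le_trans (by linarith) h
  refine ⟨hnear, fun x => ?_⟩
  rcases le_total ‖x‖ (r₀ * exp (-s)) with hx | hx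
  · exact hM.trans (hnear x hx)
  · exact diffPot_nonneg hk hl ha (by linarith) (by linarith) (har.trans hx)

lemma integral_tailPot_le {d : ℕ} (hd : 1 ≤ d) {f : Euc d → ℝ} {a : ℝ} {e : Euc d}
    (hf : IsRadDensity f a) (he : ‖e‖ = 1) (ha : 0 < a) (ha4 : a ≤ 1 / 4)
    (hk : IsKer d (sphArea d)⁻¹ a (radKer d (profile e f))) (ht : ∀ x, 0 ≤ tailPot e f x)
    (p : Euc d) :
    ∫ x, tailPot e f (x - p) ≤ (sphArea d)⁻¹ * ∫ x, truncRiesz d x := by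
  have hA : 0 ≤ (sphArea d)⁻¹ := (inv_pos.2 (sphArea_pos hd)).le
  have : Nontrivial (Euc d) := ⟨e, 0, fun h => by simp [h] at he⟩
  rw [integral_sub_right_eq_self (tailPot e f) p (μ := volume), ← integral_const_mul]
  refine integral_mono_of_nonneg (.of_forall ht) ((integrable_truncRiesz hd).const_mul _) ?_
  have h0 : ∀ᵐ x : Euc d, x ≠ 0 := by simp [ae_iff]
  filter_upwards [h0] with x hx
  exact diffPot_le hk (hf.isKer_ballAvg he hd ha) (by linarith) (by linarith) hA hx

lemma le_integral_mul_tailPot {d : ℕ} (hd : 1 ≤ d) {f : Euc d → ℝ} {a : ℝ} {e : Euc d}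
    (hf : IsRadDensity f a) (he : ‖e‖ = 1) (ha : 0 < a) (ha4 : a ≤ 1 / 4)
    (hk : IsKer d (sphArea d)⁻¹ a (radKer d (profile e f))) {M r : ℝ}
    (hM : ∀ x, ‖x‖ ≤ r → M ≤ tailPot e f x) {p z : Euc d} (hz : a + dist p z ≤ r) :
    M ≤ ∫ x, f (x - z) * tailPot e f (x - p) := by
  have h1 : ∫ x, f (x - z) * M = M := by
    rw [integral_mul_const, integral_sub_right_eq_self f z (μ := volume), hf.integral_eq, one_mul]
  rw [← h1]
  refine integral_mono ((hf.integrable.comp_sub_right z).mul_const M)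
    (integrable_mul_tailPot (hf.integrable.comp_sub_right z) hf he hd ha ha4 hk p) fun x => ?_
  rcases lt_or_ge a ‖x - z‖ with hx | hx
  · simp [hf.supp _ hx]
  · refine mul_le_mul_of_nonneg_left (hM _ ?_) (hf.nonneg _)
    rw [← dist_eq_norm] at hx ⊢
    linarith [dist_triangle x z p, dist_comm z p]

lemma integrable_mul_of_hasCompactSupport {d : ℕ} {f φ : Euc d → ℝ} (hf : Integrable f)
    (hφ : Continuous φ) (hc : HasCompactSupport φ) : Integrable fun x => f x * φ x := by
  obtain ⟨M, hM⟩ := hc.exists_bound_of_continuous hφ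
  exact hf.mul_bdd hφ.aestronglyMeasurable (.of_forall hM)

lemma integral_jellium_mul {d : ℕ} {f φ : Euc d → ℝ} (hf : Integrable f) (hφ : Continuous φ)
    (hc : HasCompactSupport φ) (c : ℝ) (Λ : Finset (Euc d)) (N : Euc d → ℕ) :
    ∫ x, c * ((∑ z ∈ Λ, (N z : ℝ) * f (x - z)) - 1) * φ x =
      c * ((∑ z ∈ Λ, (N z : ℝ) * ∫ x, f (x - z) * φ x) - ∫ x, φ x) := by
  have h1 : ∀ z, Integrable fun x => (N z : ℝ) * (f (x - z) * φ x) := fun z =>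
    (integrable_mul_of_hasCompactSupport (hf.comp_sub_right z) hφ hc).const_mul _
  have h2 : ∀ x, c * ((∑ z ∈ Λ, (N z : ℝ) * f (x - z)) - 1) * φ x =
      c * ((∑ z ∈ Λ, (N z : ℝ) * (f (x - z) * φ x)) - φ x) := by
    intro x
    rw [mul_assoc, sub_mul, Finset.sum_mul, one_mul]
    simp only [mul_assoc]
  simp_rw [h2]
  rw [integral_const_mul, integral_sub (integrable_finsetSum _ fun z _ => h1 z)
    (hφ.integrable_of_hasCompactSupport hc), integral_finsetSum _ fun z _ => h1 z]
  simp_rw [integral_const_mul]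

/-- A configuration of points with multiplicities in which one point has been moved. -/
lemma exists_moved_configuration {α : Type*} (Λ : Finset α) (N : α → ℕ)
    {p : α} (hp : p ∈ Λ) (hN : 1 ≤ N p) (y : α) :
    ∃ (Λ' : Finset α) (N' : α → ℕ), (∀ z ∈ Λ', z = y ∨ z ∈ Λ) ∧ (∀ z ∈ Λ', 1 ≤ N' z) ∧
      ∀ I : α → ℝ, ∑ z ∈ Λ', (N' z : ℝ) * I z = (∑ z ∈ Λ, (N z : ℝ) * I z) - I p + I y := by
  classical
  set N' : α → ℕ := fun z =>
    (if z ∈ Λ then N z - (if z = p then 1 else 0) else 0) + if z = y then 1 else 0 with hN'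
  refine ⟨(insert y Λ).filter fun z => 1 ≤ N' z, N', fun z hz => ?_,
    fun z hz => (Finset.mem_filter.1 hz).2, fun I => ?_⟩
  · exact Finset.mem_insert.1 (Finset.mem_filter.1 hz).1
  · rw [Finset.sum_filter_of_ne]
    · have h1 : ∀ z, (N' z : ℝ) * I z =
          (if z ∈ Λ then (N z : ℝ) * I z - (if z = p then I z else 0) else 0) +
            if z = y then I z else 0 := by
        intro z
        simp only [hN']
        push_cast
        rw [add_mul]
        congr 1
        · split_ifs with h h'
          · subst h'
            rw [Nat.cast_sub hN]
            push_cast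
            ring
          · simp
          · simp
        · split_ifs <;> simp
      simp_rw [h1, Finset.sum_add_distrib]
      rw [Finset.sum_ite_mem, Finset.inter_eq_right.2 (Finset.subset_insert _ _),
        Finset.sum_sub_distrib, Finset.sum_ite_eq' _ p, Finset.sum_ite_eq' _ y]
      simp [hp]
    · intro z _ hz
      by_contra h
      exact hz (by rw [Nat.lt_one_iff.1 (not_le.1 h)]; simp)

lemma isCompact_box {d : ℕ} (a b : Fin d → ℝ) :
    IsCompact {x : Euc d | ∀ i, x i ∈ Set.Icc (a i) (b i)} := by
  have h := (isCompact_univ_pi fun i => isCompact_Icc (a := a i) (b := b i)).image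
    (PiLp.continuous_toLp 2 fun _ : Fin d => ℝ)
  convert h using 1
  ext x
  constructor
  · exact fun hx => ⟨x.ofLp, fun i _ => hx i, rfl⟩
  · rintro ⟨y, hy, rfl⟩ i
    exact hy i trivial

lemma convex_box {d : ℕ} (a b : Fin d → ℝ) :
    Convex ℝ {x : Euc d | ∀ i, x i ∈ Set.Icc (a i) (b i)} := by
  intro x hx y hy s t hs ht hst i
  exact convex_Icc (a i) (b i) (hx i) (hy i) hs ht hst

lemma ae_restrict_mem_interior {d : ℕ} {K : Set (Euc d)} (hK : IsCompact K) (hc : Convex ℝ K) :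
    ∀ᵐ x ∂volume.restrict K, x ∈ interior K := by
  have h1 : ∀ᵐ x : Euc d, x ∉ frontier K :=
    measure_eq_zero_iff_ae_notMem.1 (hc.addHaar_frontier volume)
  filter_upwards [ae_restrict_of_ae h1, ae_restrict_mem hK.measurableSet] with x hx hxK
  by_contra h
  exact hx ⟨subset_closure hxK, h⟩

lemma continuousOn_gradient {d : ℕ} {U : Set (Euc d)} (hU : IsOpen U) {h : Euc d → ℝ}
    (hh : ContDiffOn ℝ 1 h U) : ContinuousOn (gradient h) U :=
  (InnerProductSpace.toDual ℝ (Euc d)).symm.continuous.comp_continuousOn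
    (hh.continuousOn_fderiv_of_isOpen hU le_rfl)

lemma memLp_gradient {d : ℕ} {K : Set (Euc d)} (hK : IsCompact K) (hc : Convex ℝ K)
    {h : Euc d → ℝ} (hh : ContDiffOn ℝ 1 h (interior K))
    (hi : IntegrableOn (fun x => ‖gradient h x‖ ^ 2) K) :
    MemLp (gradient h) 2 (volume.restrict K) := by
  have hr : volume.restrict K = volume.restrict (interior K) := by
    refine Measure.restrict_congr_set ?_
    have h1 := (ae_restrict_iff' hK.measurableSet).1 (ae_restrict_mem_interior hK hc)
    filter_upwards [h1] with x hx
    exact propext ⟨fun h => hx h, fun h => interior_subset h⟩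
  have hm : AEStronglyMeasurable (gradient h) (volume.restrict K) := by
    rw [hr]
    exact (continuousOn_gradient isOpen_interior hh).aestronglyMeasurable
      isOpen_interior.measurableSet
  exact (memLp_two_iff_integrable_sq_norm hm).2 hi

/-- If the potential of `p` is tested against sufficiently many charges, moving one charge away
from `p` lowers the energy. -/
lemma exists_jellium_energy_le {d : ℕ} (hd : 2 ≤ d) {ρ : Euc d → ℝ} {η : ℝ} (hη : 0 < η)
    (hf : IsRadDensity (smear d ρ η 0) η) {K : Set (Euc d)} (hK : IsCompact K)
    (hc : Convex ℝ K) {Λ : Finset (Euc d)} (hΛ : ↑Λ ⊆ K) {N : Euc d → ℕ}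
    (hN : ∀ p ∈ Λ, 1 ≤ N p) {h : Euc d → ℝ} (hh : ContDiffOn ℝ 1 h (interior K))
    (hi : IntegrableOn (fun x => ‖gradient h x‖ ^ 2) K) (hw : WeakJellium d ρ η K Λ N h)
    {p : Euc d} (hp : p ∈ Λ) (hpK : closedBall p (3 / 4) ⊆ interior K) {e : Euc d} (he : ‖e‖ = 1)
    (hk : IsKer d (sphArea d)⁻¹ η (radKer d (profile e (smear d ρ η 0)))) {q : Euc d}
    (hq : ‖q‖ ≤ 1 / 2) :
    ∃ (Λ' : Finset (Euc d)) (N' : Euc d → ℕ) (h' : Euc d → ℝ),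
      ↑Λ' ⊆ K ∧ (∀ p ∈ Λ', 1 ≤ N' p) ∧ ContDiffOn ℝ 1 h' (interior K) ∧
      IntegrableOn (fun x => ‖gradient h' x‖ ^ 2) K ∧ WeakJellium d ρ η K Λ' N' h' ∧
      ∫ x in K, ‖gradient h' x‖ ^ 2 = ∫ x in K, ‖gradient h x +
        gradient (movePot e (smear d ρ η 0) (cConst d) p q) x‖ ^ 2 := by
  have hd1 : 1 ≤ d := by omega
  set f := smear d ρ η 0 with hfdef
  set c := cConst d
  obtain ⟨Λ', N', hsub, hN', hsum⟩ := exists_moved_configuration Λ N hp (hN p hp) (p + q)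
  have hψ := contDiff_movePot hf he hd1 hη hk c p q
  have hψd := hψ.differentiable one_ne_zero
  have hgrad : ∀ x ∈ interior K, gradient (fun y => h y + movePot e f c p q y) x =
      gradient h x + gradient (movePot e f c p q) x := by
    intro x hx
    have h1 : DifferentiableAt ℝ h x :=
      (hh.differentiableOn one_ne_zero).differentiableAt (isOpen_interior.mem_nhds hx)
    unfold gradient
    rw [fderiv_fun_add h1 (hψd x), map_add]
  have hae : (fun x => ‖gradient (fun y => h y + movePot e f c p q y) x‖ ^ 2)
      =ᵐ[volume.restrict K] fun x => ‖gradient h x + gradient (movePot e f c p q) x‖ ^ 2 := by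
    filter_upwards [ae_restrict_mem_interior hK hc] with x hx
    rw [hgrad x hx]
  have hfin : IsFiniteMeasure (volume.restrict K) := ⟨by
    rw [Measure.restrict_apply_univ]; exact hK.measure_lt_top⟩
  obtain ⟨M, hM⟩ := exists_norm_gradient_movePot_le hf he hd1 hη hk c p q
  have hψL : MemLp (gradient (movePot e f c p q)) 2 (volume.restrict K) :=
    MemLp.of_bound (continuous_gradient hψ).aestronglyMeasurable M (.of_forall hM)
  refine ⟨Λ', N', fun y => h y + movePot e f c p q y, fun z hz => ?_, hN',
    hh.add hψ.contDiffOn, ?_, fun φ hφ hφc hφs => ?_, integral_congr_ae hae⟩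
  · rcases hsub z hz with rfl | hz
    · refine interior_subset (hpK ?_)
      rw [mem_closedBall, dist_eq_norm, add_sub_cancel_left]
      linarith
    · exact hΛ hz
  · exact (((memLp_gradient hK hc hh hi).add hψL).integrable_norm_pow two_ne_zero).congr hae.symm
  · have hφ1 : ContDiff ℝ 1 φ := hφ.of_le (by exact_mod_cast le_top)
    have e1 : ∀ x, ⟪gradient (fun y => h y + movePot e f c p q y) x, gradient φ x⟫ =
        ⟪gradient h x, gradient φ x⟫ + ⟪gradient (movePot e f c p q) x, gradient φ x⟫ := by
      intro x
      by_cases hx : x ∈ interior K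
      · rw [hgrad x hx, inner_add_left]
      · rw [gradient_eq_zero_of_notMem_tsupport fun h => hx (hφs h)]
        simp
    simp_rw [e1]
    rw [integral_add (integrable_inner_gradient
      (continuousOn_gradient isOpen_interior hh) hφ1 hφc hφs)
      (integrable_inner_gradient_of_continuous (continuous_gradient hψ) hφ1 hφc), hw φ hφ hφc hφs,
      integral_inner_gradient_movePot hf he hd1 hη hk c p q hφ1 hφc, hsum]
    simp_rw [smear_eq_sub ρ η p, smear_eq_sub ρ η (p + q)]
    ring

lemma integral_inner_gradient_tailPot {d : ℕ} (hd : 2 ≤ d) {ρ : Euc d → ℝ} {η : ℝ} (hη : 0 < η)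
    (hη4 : η ≤ 1 / 4)
    (hf : IsRadDensity (smear d ρ η 0) η) {K : Set (Euc d)} {Λ : Finset (Euc d)} {N : Euc d → ℕ}
    (hN : ∀ p ∈ Λ, 1 ≤ N p) {h : Euc d → ℝ} (hh : ContDiffOn ℝ 1 h (interior K))
    (hw : WeakJellium d ρ η K Λ N h)
    {p : Euc d} (hp : p ∈ Λ) (hpK : closedBall p (3 / 4) ⊆ interior K) {e : Euc d}
    (he : ‖e‖ = 1) :
    IsKer d (sphArea d)⁻¹ η (radKer d (profile e (smear d ρ η 0))) ∧
    ∫ x, ⟪gradient h x, gradient (fun y => tailPot e (smear d ρ η 0) (y - p)) x⟫ =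
      cConst d * ((∑ z ∈ Λ, (N z : ℝ) *
        ∫ x, smear d ρ η 0 (x - z) * tailPot e (smear d ρ η 0) (x - p)) -
          ∫ x, tailPot e (smear d ρ η 0) (x - p)) := by
  have hd1 : 1 ≤ d := by omega
  set f := smear d ρ η 0 with hfdef
  have hV := continuousOn_gradient isOpen_interior hh
  set m : Euc d → ℝ := fun x => ∑ z ∈ Λ, (N z : ℝ) * f (x - z) with hm
  have hmi : Integrable m :=
    integrable_finsetSum _ fun z _ => (hf.integrable.comp_sub_right z).const_mul _
  have hmf : ∀ x, f (x - p) ≤ m x := by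
    intro x
    refine le_trans ?_ (Finset.single_le_sum (f := fun z => (N z : ℝ) * f (x - z))
      (fun z _ => mul_nonneg (Nat.cast_nonneg _) (hf.nonneg _)) hp)
    exact le_mul_of_one_le_left (hf.nonneg _) (by exact_mod_cast hN p hp)
  have hwd : ∀ φ : Euc d → ℝ, ContDiff ℝ (⊤ : ℕ∞) φ → HasCompactSupport φ →
      tsupport φ ⊆ interior K →
      ∫ x, ⟪gradient h x, gradient φ x⟫ = ∫ x, cConst d * (m x - 1) * φ x := by
    intro φ hφ hφc hφs
    rw [hw φ hφ hφc hφs, integral_jellium_mul hf.integrable hφ.continuous hφc]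
    congr 2
    refine Finset.sum_congr rfl fun z _ => ?_
    simp_rw [smear_eq_sub ρ η z]
    rfl
  have h0 := tendsto_radKer_of_weak hd1 hf he isOpen_interior
    (hpK (mem_closedBall_self (by norm_num))) hV (cConst_pos hd) hmi.locallyIntegrable hmf hwd
  have hk := hf.isKer he hd1 hη h0
  refine ⟨hk, ?_⟩
  have ht : ContDiff ℝ 1 fun y => tailPot e f (y - p) :=
    (hf.contDiff_tailPot he hd1 hη hk).comp (contDiff_id.sub contDiff_const)
  have htc := hf.hasCompactSupport_tailPot_sub he hd1 hη hη4 hk p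
  rw [integral_inner_gradient_of_smooth isOpen_interior hV
    ((hmi.locallyIntegrable.sub (continuous_const (y := (1 : ℝ))).locallyIntegrable).smul
      (cConst d)) hwd ht htc
    ((hf.tsupport_tailPot_sub he hd1 hη hη4 hk p).trans hpK)]
  exact integral_jellium_mul hf.integrable ht.continuous htc _ Λ N

/-- **Separation of points in configurations minimizing the smeared jellium energy.**
There exist `η₀, r₀, C, R₀ > 0` depending only on `d` and `ρ` such that: for `0 < η < η₀`,
`R ≥ R₀`, `K` a closed hyperrectangle with sidelengths in `[2R, 3R]`, `Λ ⊆ K` finite with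
multiplicities `N_p ≥ 1`, and `h ∈ C¹(int K)` of finite energy solving
`−Δh = c_d(Σ N_p δ_p^{(η)} − 1)` weakly in `K`, if some interior point (at distance `≥ 1` from
`∂K`) has multiplicity `≥ 2` or two such points are at distance `< r₀`, then there is a
modified configuration `(Λ̃, Ñ, h̃)` of the same type whose energy is lower by at least `C`. -/
theorem separation_of_points
    (d : ℕ) (hd : 2 ≤ d)
    -- the fixed radial smearing function ρ
    (ρ : Euc d → ℝ) (hρmeas : Measurable ρ) (hρnonneg : ∀ x, 0 ≤ ρ x)
    (hρradial : ∀ x y : Euc d, ‖x‖ = ‖y‖ → ρ x = ρ y)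
    (hρsupp : Function.support ρ ⊆ closedBall 0 1)
    (hρint : ∫ x, ρ x = 1) :
    ∃ η₀ > (0:ℝ), ∃ r₀ > (0:ℝ), ∃ C > (0:ℝ), ∃ R₀ > (0:ℝ),
      ∀ (η R : ℝ), 0 < η → η < η₀ → R₀ ≤ R →
      ∀ (a b : Fin d → ℝ), (∀ i, b i - a i ∈ Set.Icc (2*R) (3*R)) →
      ∀ (K : Set (Euc d)), K = {x : Euc d | ∀ i, x i ∈ Set.Icc (a i) (b i)} →
      ∀ (Λ : Finset (Euc d)), ↑Λ ⊆ K →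
      ∀ (N : Euc d → ℕ), (∀ p ∈ Λ, 1 ≤ N p) →
      ∀ (h : Euc d → ℝ), ContDiffOn ℝ 1 h (interior K) →
        IntegrableOn (fun x => ‖gradient h x‖ ^ 2) K →
        WeakJellium d ρ η K Λ N h →
        ((∃ p ∈ Λ, 1 ≤ infDist p (frontier K) ∧ 2 ≤ N p) ∨
          (∃ p ∈ Λ, ∃ p' ∈ Λ, 1 ≤ infDist p (frontier K) ∧ 1 ≤ infDist p' (frontier K) ∧
            p ≠ p' ∧ dist p p' < r₀)) →
        ∃ (Λ' : Finset (Euc d)) (N' : Euc d → ℕ) (h' : Euc d → ℝ),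
          ↑Λ' ⊆ K ∧ (∀ p ∈ Λ', 1 ≤ N' p) ∧
          ContDiffOn ℝ 1 h' (interior K) ∧
          IntegrableOn (fun x => ‖gradient h' x‖ ^ 2) K ∧
          WeakJellium d ρ η K Λ' N' h' ∧
          ∫ x in K, ‖gradient h' x‖ ^ 2 ≤ (∫ x in K, ‖gradient h x‖ ^ 2) - C := by
  have hd1 : 1 ≤ d := by omega
  obtain ⟨C₁, hC₁, henergy⟩ := exists_move_energy_le d hd1
  have hc := cConst_pos hd
  set c := cConst d with hcdef
  set T := (sphArea d)⁻¹ * ∫ x : Euc d, truncRiesz d x with hT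
  have hT0 : 0 ≤ T := mul_nonneg (inv_pos.2 (sphArea_pos hd1)).le
    (integral_nonneg truncRiesz_nonneg)
  obtain ⟨r, hr0, hr2, htail⟩ := exists_le_tailPot hd
    (M := T + C₁ / 2 + 1 / (2 * c ^ 2)) (by positivity)
  refine ⟨r / 2, by positivity, r / 2, by positivity, 1, one_pos, 1, one_pos, ?_⟩
  intro η R hη hηr _ a b _ K hKdef Λ hΛ N hN h hh hi hw hcase
  have hη4 : η ≤ 1 / 4 := by linarith
  have hf := isRadDensity_smear hρmeas hρnonneg hρradial hρsupp hρint hη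
  have hK : IsCompact K := hKdef ▸ isCompact_box a b
  have hKc : Convex ℝ K := hKdef ▸ convex_box a b
  set e : Euc d := EuclideanSpace.single ⟨0, by omega⟩ 1 with hedef
  have he : ‖e‖ = 1 := by simp [hedef]
  have key : ∀ p ∈ Λ, 1 ≤ infDist p (frontier K) →
      ((∀ x, ‖x‖ ≤ r → T + C₁ / 2 + 1 / (2 * c ^ 2) ≤ tailPot e (smear d ρ η 0) x) →
        (∀ x, 0 ≤ tailPot e (smear d ρ η 0) x) →
        IsKer d (sphArea d)⁻¹ η (radKer d (profile e (smear d ρ η 0))) →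
        (∫ x, smear d ρ η 0 (x - p) * tailPot e (smear d ρ η 0) (x - p)) +
          (T + C₁ / 2 + 1 / (2 * c ^ 2)) ≤ ∑ z ∈ Λ, (N z : ℝ) *
            ∫ x, smear d ρ η 0 (x - z) * tailPot e (smear d ρ η 0) (x - p)) →
        ∃ (Λ' : Finset (Euc d)) (N' : Euc d → ℕ) (h' : Euc d → ℝ),
          ↑Λ' ⊆ K ∧ (∀ p ∈ Λ', 1 ≤ N' p) ∧
          ContDiffOn ℝ 1 h' (interior K) ∧
          IntegrableOn (fun x => ‖gradient h' x‖ ^ 2) K ∧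
          WeakJellium d ρ η K Λ' N' h' ∧
          ∫ x in K, ‖gradient h' x‖ ^ 2 ≤ (∫ x in K, ‖gradient h x‖ ^ 2) - 1 := by
    intro p hp hpd hsum
    have hpK : closedBall p (3 / 4) ⊆ interior K :=
      (closedBall_subset_ball (by norm_num)).trans
        (ball_subset_interior hK.isClosed (hΛ hp) one_pos hpd)
    obtain ⟨hk, hint⟩ := integral_inner_gradient_tailPot hd hη hη4 hf hN hh hw hp hpK he
    obtain ⟨hM, ht⟩ := htail _ η e hf he hη hη4 (by linarith) hk
    obtain ⟨q, hq, hle⟩ := henergy _ η e hf he hη hη4 hk ht c K hK (gradient h)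
      (memLp_gradient hK hKc hh hi) p (hpK.trans interior_subset)
    obtain ⟨Λ', N', h', h1, h2, h3, h4, h5, h6⟩ :=
      exists_jellium_energy_le hd hη hf hK hKc hΛ hN hh hi hw hp hpK he hk hq
    refine ⟨Λ', N', h', h1, h2, h3, h4, h5, ?_⟩
    rw [h6]
    refine hle.trans ?_
    rw [hint]
    have hs := hsum hM ht hk
    have hT' := integral_tailPot_le hd1 hf he hη hη4 hk ht p
    rw [integral_sub_right_eq_self
      (fun x => smear d ρ η 0 x * tailPot e (smear d ρ η 0) x) p (μ := volume)] at hs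
    have hm := mul_le_mul_of_nonneg_left (a := 2 * c ^ 2)
      (add_le_add hs (neg_le_neg hT')) (by positivity)
    have hcc : 2 * c ^ 2 * (1 / (2 * c ^ 2)) = 1 := by field_simp
    linarith
  have hterm : ∀ p z : Euc d, (∀ x, 0 ≤ tailPot e (smear d ρ η 0) x) →
      0 ≤ ∫ x, smear d ρ η 0 (x - z) * tailPot e (smear d ρ η 0) (x - p) := fun p z ht =>
    integral_nonneg fun x => mul_nonneg (hf.nonneg _) (ht _)
  rcases hcase with ⟨p, hp, hpd, hNp⟩ | ⟨p, hp, p', hp', hpd, -, hne, hdist⟩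
  · refine key p hp hpd fun hM ht hk => ?_
    have h1 := le_integral_mul_tailPot hd1 hf he hη hη4 hk hM (p := p) (z := p)
      (by rw [dist_self]; linarith)
    have h2 : (2 : ℝ) ≤ N p := by exact_mod_cast hNp
    refine le_trans ?_ (Finset.single_le_sum (f := fun z => (N z : ℝ) *
      ∫ x, smear d ρ η 0 (x - z) * tailPot e (smear d ρ η 0) (x - p))
      (fun z _ => mul_nonneg (Nat.cast_nonneg _) (hterm p z ht)) hp)
    have h3 := mul_le_mul_of_nonneg_right h2 (hterm p p ht)
    linarith
  · refine key p hp hpd fun hM ht hk => ?_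
    have h1 := le_integral_mul_tailPot hd1 hf he hη hη4 hk hM (p := p) (z := p') (by linarith)
    have h2 : (1 : ℝ) ≤ N p := by exact_mod_cast hN p hp
    have h3 : (1 : ℝ) ≤ N p' := by exact_mod_cast hN p' hp'
    refine le_trans ?_ (Finset.add_le_sum (f := fun z => (N z : ℝ) *
      ∫ x, smear d ρ η 0 (x - z) * tailPot e (smear d ρ η 0) (x - p))
      (fun z _ => mul_nonneg (Nat.cast_nonneg _) (hterm p z ht)) hp hp' hne)
    exact add_le_add (le_mul_of_one_le_left (hterm p p ht) h2)
      (h1.trans (le_mul_of_one_le_left (hterm p p' ht) h3))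
end
end

section
/- The jellium potential close to a point charge: Fix r_3 ∈ (0,1) with |B(0,r_3)| < 1 and define V_η : ℝ^d → ℝ by V_η(x) = ∫_{ℝ^d} w(x − z) ρ_η(z) dz − ∫_{B(0,r_3)} w(x − z) dz. For every M > 0 there exist r_1, r_2 with 0 < r_1 < r_2 < min(1/2, r_3) and η_1 > 0, depending only on M, d, ρ and r_3, such that for all 0 < η < η_1, all r ∈ (0, r_1), and all x, y ∈ ℝ^d with |x| = r + η and |y| = r_2 − η, one has V_η(y) − V_η(x) ≤ −M. -/
open MeasureTheory Metric Real Filter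
open scoped Topology ENNReal BigOperators

noncomputable section

/-- The Coulomb kernel `w` : `|x|^{2-d}` for `d ≥ 3`, `-log |x|` for `d = 2`. -/
def ck (d : ℕ) (x : Euc d) : ℝ :=
  if d = 2 then -Real.log ‖x‖ else ‖x‖ ^ ((2 : ℝ) - d)

/-- The rescaled smearing function `ρ_η(x) = η^{-d} ρ(x/η)`. -/
def rhoScaled (d : ℕ) (ρ : Euc d → ℝ) (η : ℝ) (x : Euc d) : ℝ :=
  (η ^ d)⁻¹ * ρ (η⁻¹ • x)

/-- The potential `V_η` generated by the smeared unit charge `δ_0^{(η)}` and a disc of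
constant opposite charge density: `V_η = w*δ_0^{(η)} − w*1_{B(0,r₃)}`. -/
def jelliumPot (d : ℕ) (ρ : Euc d → ℝ) (r₃ η : ℝ) (x : Euc d) : ℝ :=
  (∫ z, ck d (x - z) * rhoScaled d ρ η z) - ∫ z in ball (0 : Euc d) r₃, ck d (x - z)

/-- The radial profile of the Coulomb kernel: `ck d x = coulombProfile d ‖x‖`. -/
def coulombProfile (d : ℕ) (t : ℝ) : ℝ :=
  if d = 2 then -Real.log t else t ^ ((2 : ℝ) - d)

lemma ck_eq_coulombProfile (d : ℕ) (x : Euc d) : ck d x = coulombProfile d ‖x‖ := rfl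

lemma measurable_coulombProfile (d : ℕ) : Measurable (coulombProfile d) := by
  unfold coulombProfile
  split_ifs <;> fun_prop

lemma antitoneOn_coulombProfile {d : ℕ} (hd : 2 ≤ d) :
    AntitoneOn (coulombProfile d) (Set.Ioi 0) := by
  have hd' : (2 : ℝ) ≤ d := by exact_mod_cast hd
  intro s hs t ht hst
  unfold coulombProfile
  split_ifs
  · exact neg_le_neg (Real.log_le_log hs hst)
  · exact Real.antitoneOn_rpow_Ioi_of_exponent_nonpos (by linarith) hs ht hst

lemma tendsto_coulombProfile_nhdsGT_zero {d : ℕ} (hd : 2 ≤ d) :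
    Tendsto (coulombProfile d) (𝓝[>] 0) atTop := by
  unfold coulombProfile
  split_ifs with h
  · exact tendsto_neg_atBot_atTop.comp Real.tendsto_log_nhdsGT_zero
  · have hd' : (2 : ℝ) < d := by exact_mod_cast lt_of_le_of_ne hd (Ne.symm h)
    exact tendsto_rpow_neg_nhdsGT_zero (by linarith)

lemma integrableOn_ck_ball {d : ℕ} (hd : 2 ≤ d) (R : ℝ) :
    IntegrableOn (ck d) (ball (0 : Euc d) R) := by
  have : Nontrivial (Euc d) := by
    have : Nonempty (Fin d) := ⟨⟨0, by omega⟩⟩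
    infer_instance
  change IntegrableOn (fun x : Euc d => coulombProfile d ‖x‖) _ _
  rw [integrableOn_fun_norm_addHaar, finrank_euclideanSpace_fin]
  rcases eq_or_ne d 2 with rfl | h
  · refine IntegrableOn.mono_set ?_ Set.Ioo_subset_Icc_self
    refine (Continuous.integrableOn_Icc (Real.continuous_mul_log.neg)).congr_fun ?_
      measurableSet_Icc
    intro t _
    simp [coulombProfile]
  · refine IntegrableOn.congr_fun
      ((continuous_id.integrableOn_Icc (μ := volume) (a := 0) (b := R)).mono_set
        Set.Ioo_subset_Icc_self) ?_ measurableSet_Ioo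
    intro t ht
    have ht0 : 0 < t := ht.1
    simp only [coulombProfile, if_neg h, id, smul_eq_mul]
    rw [← Real.rpow_natCast, ← Real.rpow_add ht0, Nat.cast_sub (by omega)]
    norm_num

lemma abs_setIntegral_ck_sub_le {d : ℕ} (hd : 2 ≤ d) {r R : ℝ} {x : Euc d} (hx : ‖x‖ + r ≤ R) :
    |∫ z in ball (0 : Euc d) r, ck d (x - z)| ≤ ∫ z in ball (0 : Euc d) R, |ck d z| := by
  calc |∫ z in ball (0 : Euc d) r, ck d (x - z)|
      ≤ ∫ z in ball (0 : Euc d) r, |ck d (x - z)| := abs_integral_le_integral_abs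
    _ = ∫ z, (ball (0 : Euc d) r).indicator (fun z => |ck d (x - z)|) z :=
        (integral_indicator measurableSet_ball).symm
    _ ≤ ∫ z, (ball (0 : Euc d) R).indicator (fun z => |ck d z|) (x - z) := by
        refine integral_mono_of_nonneg
          (Eventually.of_forall fun z => Set.indicator_nonneg (fun _ _ => abs_nonneg _) z)
          (((integrable_indicator_iff measurableSet_ball).2
            (integrableOn_ck_ball hd R).abs).comp_sub_left x)
          (Eventually.of_forall fun z => ?_)
        by_cases hz : z ∈ ball (0 : Euc d) r
        · have hz' : x - z ∈ ball (0 : Euc d) R := by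
            rw [mem_ball_zero_iff] at hz ⊢
            linarith [norm_sub_le x z]
          simp [Set.indicator_of_mem hz, Set.indicator_of_mem hz']
        · simpa [Set.indicator_of_notMem hz] using
            Set.indicator_nonneg (fun _ _ => abs_nonneg _) (x - z)
    _ = ∫ z, (ball (0 : Euc d) R).indicator (fun z => |ck d z|) z :=
        integral_sub_left_eq_self _ volume x
    _ = ∫ z in ball (0 : Euc d) R, |ck d z| := integral_indicator measurableSet_ball

lemma integral_mul_mem_Icc_of_integral_eq_one {α : Type*} [MeasurableSpace α] {μ : Measure α}
    {f p : α → ℝ} {a b : ℝ} (hf : Measurable f) (hp : ∀ z, 0 ≤ p z) (hp1 : ∫ z, p z ∂μ = 1)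
    (hab : ∀ z, p z ≠ 0 → f z ∈ Set.Icc a b) :
    ∫ z, f z * p z ∂μ ∈ Set.Icc a b := by
  have hpi : Integrable p μ := by
    by_contra h
    simp [integral_undef h] at hp1
  have hlow : ∀ z, a * p z ≤ f z * p z := fun z => by
    by_cases hz : p z = 0
    · simp [hz]
    · exact mul_le_mul_of_nonneg_right (hab z hz).1 (hp z)
  have hupp : ∀ z, f z * p z ≤ b * p z := fun z => by
    by_cases hz : p z = 0
    · simp [hz]
    · exact mul_le_mul_of_nonneg_right (hab z hz).2 (hp z)
  have hint : Integrable (fun z => f z * p z) μ :=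
    integrable_of_le_of_le (hf.aestronglyMeasurable.mul hpi.aestronglyMeasurable)
      (Eventually.of_forall hlow) (Eventually.of_forall hupp) (hpi.const_mul a) (hpi.const_mul b)
  constructor
  · simpa [integral_const_mul, hp1] using integral_mono (hpi.const_mul a) hint hlow
  · simpa [integral_const_mul, hp1] using integral_mono hint (hpi.const_mul b) hupp

lemma integral_rhoScaled (d : ℕ) (ρ : Euc d → ℝ) {η : ℝ} (hη : 0 < η) :
    ∫ z, rhoScaled d ρ η z = ∫ z, ρ z := by
  unfold rhoScaled
  rw [integral_const_mul, Measure.integral_comp_inv_smul_of_nonneg volume ρ hη.le,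
    finrank_euclideanSpace_fin, smul_eq_mul, inv_mul_cancel_left₀ (pow_pos hη d).ne']

lemma norm_le_of_rhoScaled_ne_zero {d : ℕ} {ρ : Euc d → ℝ}
    (hρsupp : Function.support ρ ⊆ closedBall 0 1) {η : ℝ} (hη : 0 < η) {z : Euc d}
    (hz : rhoScaled d ρ η z ≠ 0) : ‖z‖ ≤ η := by
  have h := hρsupp (show η⁻¹ • z ∈ Function.support ρ from right_ne_zero_of_mul hz)
  rwa [mem_closedBall_zero_iff, norm_smul, norm_inv, Real.norm_of_nonneg hη.le,
    inv_mul_le_iff₀ hη, mul_one] at h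

/-- Away from the smeared charge, its potential lies between the values of the Coulomb kernel at
the largest and at the smallest distance to the charge. -/
lemma integral_ck_mul_rhoScaled_mem_Icc {d : ℕ} (hd : 2 ≤ d) {ρ : Euc d → ℝ}
    (hρnonneg : ∀ x, 0 ≤ ρ x) (hρsupp : Function.support ρ ⊆ closedBall 0 1)
    (hρint : ∫ x, ρ x = 1) {η : ℝ} (hη : 0 < η) {x : Euc d} (hx : η < ‖x‖) :
    ∫ z, ck d (x - z) * rhoScaled d ρ η z ∈
      Set.Icc (coulombProfile d (‖x‖ + η)) (coulombProfile d (‖x‖ - η)) := by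
  refine integral_mul_mem_Icc_of_integral_eq_one
    ((measurable_coulombProfile d).comp (measurable_const.sub measurable_id).norm)
    (fun z => mul_nonneg (by positivity) (hρnonneg _))
    ((integral_rhoScaled d ρ hη).trans hρint) fun z hz => ?_
  have hzη := norm_le_of_rhoScaled_ne_zero hρsupp hη hz
  have hlow := norm_sub_norm_le x z
  have hupp := norm_sub_le x z
  exact ⟨antitoneOn_coulombProfile hd (Set.mem_Ioi.2 (by linarith))
      (Set.mem_Ioi.2 (by linarith)) (by linarith),
    antitoneOn_coulombProfile hd (Set.mem_Ioi.2 (by linarith))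
      (Set.mem_Ioi.2 (by linarith)) (by linarith)⟩

/-- **The jellium potential close to a point charge.** Fix `r₃ ∈ (0,1)` with `|B(0,r₃)| < 1`.
For every `M > 0` there exist `0 < r₁ < r₂ < min(1/2, r₃)` and `η₁ > 0`, depending only on
`M`, `d`, `ρ` and `r₃`, such that for all `0 < η < η₁`, all `r ∈ (0, r₁)` and all
`x, y ∈ ℝ^d` with `|x| = r + η` and `|y| = r₂ − η`, one has `V_η(y) − V_η(x) ≤ −M`. -/
theorem jellium_potential_close_to_point_charge
    (d : ℕ) (hd : 2 ≤ d)
    -- the fixed radial smearing function ρ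
    (ρ : Euc d → ℝ) (hρmeas : Measurable ρ) (hρnonneg : ∀ x, 0 ≤ ρ x)
    (hρradial : ∀ x y : Euc d, ‖x‖ = ‖y‖ → ρ x = ρ y)
    (hρsupp : Function.support ρ ⊆ closedBall 0 1)
    (hρint : ∫ x, ρ x = 1)
    (r₃ : ℝ) (hr₃0 : 0 < r₃) (hr₃1 : r₃ < 1)
    (hr₃vol : (volume (ball (0 : Euc d) r₃)).toReal < 1) :
    ∀ M : ℝ, 0 < M →
      ∃ r₁ r₂ η₁ : ℝ, 0 < r₁ ∧ r₁ < r₂ ∧ r₂ < min (1/2) r₃ ∧ 0 < η₁ ∧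
        ∀ η : ℝ, 0 < η → η < η₁ →
        ∀ r : ℝ, 0 < r → r < r₁ →
        ∀ x y : Euc d, ‖x‖ = r + η → ‖y‖ = r₂ - η →
          jelliumPot d ρ r₃ η y - jelliumPot d ρ r₃ η x ≤ -M := by
  intro M _
  obtain ⟨s, hs⟩ : ∃ s, s = min (1 / 2) r₃ / 2 := ⟨_, rfl⟩
  have hmin : 0 < min (1 / 2) r₃ := lt_min (by norm_num) hr₃0
  have hs0 : 0 < s := by linarith
  have hs4 : s ≤ 1 / 4 := by linarith [min_le_left (1 / 2) r₃]
  set C := ∫ z in ball (0 : Euc d) 2, |ck d z|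
  obtain ⟨δ, hδ0, hδ⟩ := mem_nhdsGT_iff_exists_Ioo_subset.1
    ((tendsto_coulombProfile_nhdsGT_zero hd).eventually_ge_atTop
      (M + 2 * C + coulombProfile d (s / 2)))
  have hδ0 : 0 < δ := hδ0
  have hm : 0 < min δ s := lt_min hδ0 hs0
  have hmδ := min_le_left δ s
  have hms := min_le_right δ s
  refine ⟨min δ s / 2, s, min δ s / 4, by linarith, by linarith, by linarith, by linarith, ?_⟩
  intro η hη hη1 r hr hr1 x y hx hy
  have hxpot := (integral_ck_mul_rhoScaled_mem_Icc hd hρnonneg hρsupp hρint hη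
    (x := x) (by linarith)).1
  have hypot := (integral_ck_mul_rhoScaled_mem_Icc hd hρnonneg hρsupp hρint hη
    (x := y) (by linarith)).2
  have hxδ : M + 2 * C + coulombProfile d (s / 2) ≤ coulombProfile d (‖x‖ + η) :=
    hδ ⟨by linarith, by linarith⟩
  have hys : coulombProfile d (‖y‖ - η) ≤ coulombProfile d (s / 2) :=
    antitoneOn_coulombProfile hd (Set.mem_Ioi.2 (by linarith))
      (Set.mem_Ioi.2 (by linarith)) (by linarith)
  have hxback := (abs_le.1 (abs_setIntegral_ck_sub_le hd (r := r₃) (R := 2) (x := x)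
    (by linarith))).2
  have hyback := (abs_le.1 (abs_setIntegral_ck_sub_le hd (r := r₃) (R := 2) (x := y)
    (by linarith))).1
  unfold jelliumPot
  linarith
end
end
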